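/- arXiv:1602.05799 — 4 statements merged into one kernel-verified Lean document; each statement's English description precedes it below -/
import Mathlib

section
/- Let G be a group, F an algebraically closed field of characteristic zero, and let L = ⊕_{g∈G} L_g be a finite dimensional G-graded Lie algebra over F. If L is graded simple, then L is a semisimple Lie algebra. -/
/-- A `G`-grading on a Lie algebra `L` over `F`: a vector space direct sum decomposition
`L = ⊕_{g ∈ G} 𝒜 g` such that `⁅𝒜 g, 𝒜 h⁆ ⊆ 𝒜 (g * h)` for all `g h : G`. -/
def IsLieGrading {G F L : Type*} [Group G] [Field F] [LieRing L] [LieAlgebra F L]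
    (𝒜 : G → Submodule F L) : Prop :=
  letI : DecidableEq G := Classical.decEq G
  DirectSum.IsInternal 𝒜 ∧
    ∀ g h : G, ∀ x ∈ 𝒜 g, ∀ y ∈ 𝒜 h, ⁅x, y⁆ ∈ 𝒜 (g * h)

/-- A subspace `V` of a `G`-graded Lie algebra is graded (homogeneous) if it is the
sum of its homogeneous components, i.e. `V = ⊕_{g ∈ G} (V ∩ L_g)`. -/
def IsGradedSubspace {G F L : Type*} [Group G] [Field F] [LieRing L] [LieAlgebra F L]
    (𝒜 : G → Submodule F L) (V : Submodule F L) : Prop :=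
  V = ⨆ g : G, 𝒜 g ⊓ V

/-- A `G`-graded Lie algebra is graded simple if `⁅L, L⁆ ≠ 0` and the only graded
ideals of `L` are `0` and `L`. -/
def IsGradedSimple {G F L : Type*} [Group G] [Field F] [LieRing L] [LieAlgebra F L]
    (𝒜 : G → Submodule F L) : Prop :=
  (∃ x y : L, ⁅x, y⁆ ≠ 0) ∧
    ∀ I : LieIdeal F L, IsGradedSubspace 𝒜 I.toSubmodule → I = ⊥ ∨ I = ⊤

namespace IsLieGrading

variable {G F L : Type*} [Group G] [Field F] [LieRing L] [LieAlgebra F L]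
  {𝒜 : G → Submodule F L}

lemma iSup_eq_top (h : IsLieGrading 𝒜) : ⨆ g, 𝒜 g = ⊤ := by
  classical
  exact DirectSum.IsInternal.submodule_iSup_eq_top (A := 𝒜) (by convert h.1)

/-- Homogeneous elements are orthogonal for the Killing form unless their degrees are mutually
inverse. -/
lemma killingForm_eq_zero [FiniteDimensional F L] (h : IsLieGrading 𝒜) {g k : G}
    (hgk : g * k ≠ 1) {x y : L} (hx : x ∈ 𝒜 g) (hy : y ∈ 𝒜 k) :
    killingForm F L x y = 0 := by
  classical
  have hint : DirectSum.IsInternal 𝒜 := by convert h.1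
  rw [killingForm_apply_apply]
  refine LinearMap.trace_eq_zero_of_mapsTo_ne hint (fun i ↦ g * k * i)
    (fun i hi ↦ hgk (mul_eq_right.mp hi)) fun i z hz ↦ ?_
  have := h.2 g (k * i) x hx _ (h.2 k i y hy z hz)
  simpa [mul_assoc] using this

lemma isGradedSubspace_killingCompl_top [FiniteDimensional F L] (h : IsLieGrading 𝒜) :
    IsGradedSubspace 𝒜 (LieIdeal.killingCompl F L ⊤).toSubmodule := by
  classical
  refine le_antisymm (fun x hx ↦ ?_) (iSup_le fun g ↦ inf_le_right)
  have hx' : ∀ y, killingForm F L y x = 0 := fun y ↦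
    (LieIdeal.mem_killingCompl F L ⊤).mp hx y (LieSubmodule.mem_top y)
  obtain ⟨f, hf, rfl⟩ := (Submodule.mem_iSup_iff_exists_finsupp 𝒜 x).mp
    (h.iSup_eq_top ▸ Submodule.mem_top)
  refine Submodule.sum_mem _ fun g hg ↦ Submodule.mem_iSup_of_mem g ⟨hf g, ?_⟩
  refine (LieIdeal.mem_killingCompl F L ⊤).mpr fun y _ ↦ ?_
  have hy : y ∈ ⨆ g, 𝒜 g := h.iSup_eq_top ▸ Submodule.mem_top
  induction hy using Submodule.iSup_induction' with
  | mem k y hy =>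
    by_cases hkg : k * g = 1
    · rw [← hx' y, Finsupp.sum, map_sum (killingForm F L y)]
      rw [Finset.sum_eq_single_of_mem g hg]
      intro j _ hj
      exact h.killingForm_eq_zero (fun hkj ↦ hj (mul_left_cancel (hkj.trans hkg.symm))) hy (hf j)
    · exact h.killingForm_eq_zero hkg hy (hf g)
  | zero => simp
  | add y z _ _ hy hz =>
    rw [map_add, LinearMap.add_apply, hy (LieSubmodule.mem_top y), hz (LieSubmodule.mem_top z),
      add_zero]

lemma isGradedSubspace_derivedSeries_one (h : IsLieGrading 𝒜) :
    IsGradedSubspace 𝒜 (LieAlgebra.derivedSeries F L 1).toSubmodule := by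
  refine le_antisymm ?_ (iSup_le fun g ↦ inf_le_right)
  have hspan : (LieAlgebra.derivedSeries F L 1).toSubmodule =
      Submodule.span F {⁅x, y⁆ | (x : L) (y : L)} := LieAlgebra.coe_derivedSeries_one_eq ..
  rw [hspan, Submodule.span_le]
  rintro _ ⟨x, y, rfl⟩
  have hx : x ∈ ⨆ g, 𝒜 g := h.iSup_eq_top ▸ Submodule.mem_top
  have hy : y ∈ ⨆ g, 𝒜 g := h.iSup_eq_top ▸ Submodule.mem_top
  rw [SetLike.mem_coe]
  induction hx using Submodule.iSup_induction' with
  | mem g x hx =>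
    induction hy using Submodule.iSup_induction' with
    | mem k y hy =>
      exact Submodule.mem_iSup_of_mem (g * k)
        ⟨h.2 g k x hx y hy, Submodule.subset_span ⟨x, y, rfl⟩⟩
    | zero => simp
    | add y z _ _ hy hz => simpa using add_mem hy hz
  | zero => simp
  | add x z _ _ hx hz => simpa using add_mem hx hz

end IsLieGrading

/-- A finite dimensional graded simple Lie algebra over an algebraically
closed field of characteristic zero is semisimple (its solvable radical is zero). -/
theorem gradedSimple_radical_eq_bot {G F L : Type*} [Group G] [Field F] [IsAlgClosed F]
    [CharZero F] [LieRing L] [LieAlgebra F L] [FiniteDimensional F L]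
    (𝒜 : G → Submodule F L) (hgr : IsLieGrading 𝒜) (hs : IsGradedSimple 𝒜) :
    LieAlgebra.radical F L = ⊥ := by
  have hD : LieAlgebra.derivedSeries F L 1 ≠ ⊥ := by
    obtain ⟨x, y, hxy⟩ := hs.1
    have hmem : ⁅x, y⁆ ∈ LieAlgebra.derivedSeries F L 1 :=
      LieSubmodule.lie_mem_lie (LieSubmodule.mem_top x) (LieSubmodule.mem_top y)
    exact fun hbot ↦ hxy (by rwa [hbot, LieSubmodule.mem_bot] at hmem)
  rcases hs.2 _ hgr.isGradedSubspace_killingCompl_top with hK | hK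
  · have : LieAlgebra.IsKilling F L := ⟨hK⟩
    exact LieAlgebra.HasTrivialRadical.radical_eq_bot
  · have hsolv : LieAlgebra.IsSolvable L :=
      LieAlgebra.isSolvable_of_killingForm_apply_lie_eq_zero (R := F) fun x y _ ↦
        (LieIdeal.mem_killingCompl F L ⊤).mp (by rw [hK]; exact LieSubmodule.mem_top y) x
          (LieSubmodule.mem_top x)
    have : Nontrivial L := by
      obtain ⟨x, y, hxy⟩ := hs.1
      exact ⟨_, _, hxy⟩
    rcases hs.2 _ hgr.isGradedSubspace_derivedSeries_one with h | h
    · exact absurd h hD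
    · exact absurd h (LieAlgebra.derivedSeries_lt_top_of_solvable F L).ne
end

section
/- Let G be a group, F an algebraically closed field of characteristic zero, and let L = ⊕_{g∈G} L_g be a finite dimensional semisimple G-graded Lie algebra over F. Then L decomposes as a direct sum L = A_1 ⊕ ... ⊕ A_m of graded ideals A_1, ..., A_m, each of which is graded simple (as a G-graded Lie algebra with the induced grading), and for each i the support Supp A_i is a commutative subset of G (any two of its elements commute). -/
section Grading

variable {G F L : Type*} [Group G] [Field F] [LieRing L] [LieAlgebra F L]
  {𝒜 : G → Submodule F L}

lemma IsLieGrading.iSupIndep (h : IsLieGrading 𝒜) : iSupIndep 𝒜 := by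
  classical
  exact DirectSum.IsInternal.submodule_iSupIndep h.1

lemma IsLieGrading.iSup_eq_top_s6 (h : IsLieGrading 𝒜) : ⨆ g, 𝒜 g = ⊤ := by
  classical
  exact DirectSum.IsInternal.submodule_iSup_eq_top h.1

lemma isLieGrading_iff : IsLieGrading 𝒜 ↔ iSupIndep 𝒜 ∧ ⨆ g, 𝒜 g = ⊤ ∧
    ∀ g h : G, ∀ x ∈ 𝒜 g, ∀ y ∈ 𝒜 h, ⁅x, y⁆ ∈ 𝒜 (g * h) := by
  classical
  unfold IsLieGrading
  rw [DirectSum.isInternal_submodule_iff_iSupIndep_and_iSup_eq_top, and_assoc]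

lemma isGradedSubspace_iff_le {V : Submodule F L} :
    IsGradedSubspace 𝒜 V ↔ V ≤ ⨆ g, 𝒜 g ⊓ V :=
  ⟨fun h ↦ h.le, fun h ↦ le_antisymm h (iSup_le fun _ ↦ inf_le_right)⟩

lemma IsLieGrading.isGradedSubspace_inf (h : IsLieGrading 𝒜) {V W : Submodule F L}
    (hV : IsGradedSubspace 𝒜 V) (hW : IsGradedSubspace 𝒜 W) : IsGradedSubspace 𝒜 (V ⊓ W) := by
  classical
  let := h.1.chooseDecomposition
  have key {U : Submodule F L} (hU : IsGradedSubspace 𝒜 U) {x : L} (hx : x ∈ U) (g : G) :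
      (DirectSum.decompose 𝒜 x g : L) ∈ U := by
    replace hx : x ∈ ⨆ g, 𝒜 g ⊓ U := hU.le hx
    induction hx using Submodule.iSup_induction' with
    | zero => simp
    | add x y _ _ hx hy =>
      rw [DirectSum.decompose_add, DirectSum.add_apply, Submodule.coe_add]
      exact U.add_mem hx hy
    | mem k x hx =>
      by_cases hkg : k = g
      · subst hkg
        rw [DirectSum.decompose_of_mem_same 𝒜 hx.1]
        exact hx.2
      · rw [DirectSum.decompose_of_mem_ne 𝒜 hx.1 hkg]
        exact zero_mem U
  refine isGradedSubspace_iff_le.mpr fun x hx ↦ ?_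
  rw [← DirectSum.sum_support_decompose 𝒜 x]
  exact sum_mem fun g _ ↦ Submodule.mem_iSup_of_mem g
    ⟨SetLike.coe_mem _, key hV hx.1 g, key hW hx.2 g⟩

lemma isGradedSubspace_sSup {S : Set (LieIdeal F L)}
    (hS : ∀ I ∈ S, IsGradedSubspace 𝒜 I.toSubmodule) :
    IsGradedSubspace 𝒜 (sSup S).toSubmodule := by
  rw [isGradedSubspace_iff_le]
  conv_lhs => rw [sSup_eq_iSup', LieSubmodule.iSup_toSubmodule]
  refine iSup_le fun I ↦ (hS I I.2).le.trans (iSup_mono fun g ↦ inf_le_inf_left _ ?_)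
  exact LieSubmodule.toSubmodule_le_toSubmodule _ _ |>.mpr (le_sSup I.2)

lemma IsLieGrading.lie_eq_zero (h : IsLieGrading 𝒜) {a b : G} (hab : a * b ≠ b * a) {x y : L}
    (hx : x ∈ 𝒜 a) (hy : y ∈ 𝒜 b) : ⁅x, y⁆ = 0 := by
  have h₁ := h.2 _ _ _ hx _ hy
  have h₂ : ⁅x, y⁆ ∈ 𝒜 (b * a) := by
    rw [← lie_skew]
    exact neg_mem (h.2 _ _ _ hy _ hx)
  exact Submodule.disjoint_def.mp (h.iSupIndep.pairwiseDisjoint hab) _ h₁ h₂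

/-- The span of those homogeneous elements with degree in `Z` which commute with all homogeneous
elements whose degree is not in `Z`. It is a graded ideal. -/
def gradedCentralizerIdeal (h : IsLieGrading 𝒜) (Z : Subgroup G) : LieIdeal F L where
  toSubmodule := Submodule.span F
    {w | (∃ g ∈ Z, w ∈ 𝒜 g) ∧ ∀ k ∉ Z, ∀ z ∈ 𝒜 k, ⁅z, w⁆ = 0}
  lie_mem := by
    intro x m hm
    have hx : x ∈ ⨆ g, 𝒜 g := h.iSup_eq_top_s6 ▸ Submodule.mem_top
    induction hx using Submodule.iSup_induction' with
    | zero => simp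
    | add x y _ _ hx hy =>
      rw [add_lie]
      exact Submodule.add_mem _ hx hy
    | mem k x hx =>
      change m ∈ Submodule.span F _ at hm
      change _ ∈ Submodule.span F _
      induction hm using Submodule.span_induction with
      | zero => simp
      | add a b _ _ ha hb =>
        rw [lie_add]
        exact add_mem ha hb
      | smul c a _ ha =>
        rw [lie_smul]
        exact Submodule.smul_mem _ _ ha
      | mem w hw =>
        obtain ⟨⟨g, hg, hwg⟩, hw⟩ := hw
        by_cases hk : k ∈ Z
        · refine Submodule.subset_span ⟨⟨k * g, Z.mul_mem hk hg, h.2 _ _ _ hx _ hwg⟩, ?_⟩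
          intro j hj z hz
          rw [leibniz_lie, hw j hj z hz, lie_zero, add_zero]
          exact hw (j * k) (fun hjk ↦ hj ((Z.mul_mem_cancel_right hk).mp hjk)) _
            (h.2 _ _ _ hz _ hx)
        · rw [hw k hk x hx]
          exact zero_mem _

lemma isGradedSubspace_gradedCentralizerIdeal (h : IsLieGrading 𝒜) (Z : Subgroup G) :
    IsGradedSubspace 𝒜 (gradedCentralizerIdeal h Z).toSubmodule := by
  rw [isGradedSubspace_iff_le]
  refine Submodule.span_le.mpr fun w hw ↦ ?_
  obtain ⟨g, -, hg⟩ := hw.1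
  exact Submodule.mem_iSup_of_mem g ⟨hg, Submodule.subset_span hw⟩

lemma gradedCentralizerIdeal_le (h : IsLieGrading 𝒜) (Z : Subgroup G) :
    (gradedCentralizerIdeal h Z).toSubmodule ≤ ⨆ g ∈ Z, 𝒜 g := by
  refine Submodule.span_le.mpr fun w hw ↦ ?_
  obtain ⟨g, hgZ, hg⟩ := hw.1
  exact Submodule.mem_iSup_of_mem g (Submodule.mem_iSup_of_mem hgZ hg)

/-- The support of a graded simple Lie algebra is commutative. -/
theorem IsGradedSimple.mul_comm_of_ne_bot (hs : IsGradedSimple 𝒜) (h : IsLieGrading 𝒜) {a b : G}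
    (ha : 𝒜 a ≠ ⊥) (hb : 𝒜 b ≠ ⊥) : a * b = b * a := by
  by_contra hab
  obtain ⟨x, hx, hx0⟩ := Submodule.exists_mem_ne_zero_of_ne_bot ha
  have hbZ : b ∉ Subgroup.centralizer {a} := by
    rw [Subgroup.mem_centralizer_singleton_iff]
    exact fun h ↦ hab h.symm
  have hxN : x ∈ gradedCentralizerIdeal h (Subgroup.centralizer {a}) := by
    refine Submodule.subset_span ⟨⟨a, ?_, hx⟩, fun k hk z hz ↦ h.lie_eq_zero ?_ hz hx⟩
    · rw [Subgroup.mem_centralizer_singleton_iff]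
    · rwa [Subgroup.mem_centralizer_singleton_iff] at hk
  have htop := (hs.2 _ (isGradedSubspace_gradedCentralizerIdeal h
    (Subgroup.centralizer {a}))).resolve_left fun hbot ↦ hx0 <| by
      rw [hbot] at hxN
      exact (LieSubmodule.mem_bot x).mp hxN
  have hle := gradedCentralizerIdeal_le h (Subgroup.centralizer {a})
  rw [htop] at hle
  refine hb (disjoint_self.mp ((h.iSupIndep b).mono_right ?_))
  refine le_trans le_top (hle.trans (iSup_le fun g ↦ iSup_le fun hg ↦ ?_))
  exact le_iSup₂_of_le g (by rintro rfl; exact hbZ hg) le_rfl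

/-- A graded ideal inherits a grading. -/
lemma IsLieGrading.comap_subtype (h : IsLieGrading 𝒜) {A : LieIdeal F L}
    (hA : IsGradedSubspace 𝒜 A.toSubmodule) :
    IsLieGrading (fun g => ((𝒜 g).comap A.toSubmodule.subtype : Submodule F ↥A)) := by
  refine isLieGrading_iff.mpr ⟨fun g ↦ ?_, ?_, fun g k x hx y hy ↦ h.2 g k _ hx _ hy⟩
  · refine Submodule.disjoint_def.mpr fun x hx hx' ↦ Subtype.ext ?_
    refine Submodule.disjoint_def.mp (h.iSupIndep g) x.1 hx ?_
    have hle : ⨆ (j) (_ : j ≠ g), ((𝒜 j).comap A.toSubmodule.subtype : Submodule F ↥A) ≤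
        (⨆ (j) (_ : j ≠ g), 𝒜 j).comap A.toSubmodule.subtype :=
      iSup₂_le fun j hj ↦ Submodule.comap_mono (le_iSup₂_of_le j hj le_rfl)
    exact hle hx'
  · apply Submodule.map_injective_of_injective A.toSubmodule.injective_subtype
    rw [Submodule.map_iSup]
    rw [Submodule.map_top, Submodule.range_subtype]
    refine Eq.trans (iSup_congr fun g ↦ ?_) hA.symm
    rw [inf_comm]
    exact Submodule.map_comap_subtype _ _

section Killing

variable [FiniteDimensional F L]

lemma IsLieGrading.killingForm_eq_zero_s6 (h : IsLieGrading 𝒜) {a b : G} (hab : a * b ≠ 1) {x y : L}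
    (hx : x ∈ 𝒜 a) (hy : y ∈ 𝒜 b) : killingForm F L x y = 0 := by
  classical
  rw [killingForm_apply_apply]
  refine LinearMap.trace_eq_zero_of_mapsTo_ne h.1 (fun g ↦ a * (b * g)) (fun g hg ↦ hab ?_)
    fun g z hz ↦ h.2 _ _ _ hx _ (h.2 _ _ _ hy _ hz)
  rwa [← mul_assoc, mul_eq_right] at hg

lemma IsLieGrading.isGradedSubspace_killingCompl (h : IsLieGrading 𝒜) {I : LieIdeal F L}
    (hI : IsGradedSubspace 𝒜 I.toSubmodule) :
    IsGradedSubspace 𝒜 I.killingCompl.toSubmodule := by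
  refine isGradedSubspace_iff_le.mpr fun x hx ↦ ?_
  obtain ⟨f, hf, rfl⟩ := (Submodule.mem_iSup_iff_exists_finsupp 𝒜 x).mp
    (h.iSup_eq_top_s6 ▸ Submodule.mem_top)
  refine sum_mem fun g hg ↦ Submodule.mem_iSup_of_mem g ⟨hf g, ?_⟩
  refine (LieIdeal.mem_killingCompl F L I).mpr fun y hy ↦ ?_
  replace hy : y ∈ ⨆ k, 𝒜 k ⊓ I.toSubmodule := hI.le hy
  induction hy using Submodule.iSup_induction' with
  | zero => simp
  | add y z _ _ hy hz => rw [map_add, LinearMap.add_apply, hy, hz, add_zero]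
  | mem k y hyk =>
    by_cases hkg : k * g = 1
    · have := (LieIdeal.mem_killingCompl F L I).mp hx y hyk.2
      rw [Finsupp.sum, map_sum, Finset.sum_eq_single g] at this
      · exact this
      · intro j _ hj
        refine h.killingForm_eq_zero_s6 (fun hkj ↦ hj ?_) hyk.1 (hf j)
        exact mul_left_cancel (hkj.trans hkg.symm)
      · exact fun hg' ↦ absurd hg hg'
    · exact h.killingForm_eq_zero_s6 hkg hyk.1 (hf g)

end Killing

/-- `A` is minimal among the nonzero graded ideals. -/
def IsMinimalGradedIdeal (𝒜 : G → Submodule F L) (A : LieIdeal F L) : Prop :=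
  Minimal (fun I : LieIdeal F L ↦ IsGradedSubspace 𝒜 I.toSubmodule ∧ I ≠ ⊥) A

lemma IsMinimalGradedIdeal.disjoint (h : IsLieGrading 𝒜) {A B : LieIdeal F L}
    (hA : IsMinimalGradedIdeal 𝒜 A) (hB : IsMinimalGradedIdeal 𝒜 B) (hAB : A ≠ B) :
    Disjoint A B := by
  rw [disjoint_iff]
  by_contra hne
  have hgr : IsGradedSubspace 𝒜 (A ⊓ B).toSubmodule :=
    h.isGradedSubspace_inf hA.prop.1 hB.prop.1
  exact hAB (le_antisymm ((hA.le_of_le ⟨hgr, hne⟩ inf_le_left).trans inf_le_right)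
    ((hB.le_of_le ⟨hgr, hne⟩ inf_le_right).trans inf_le_left))

variable [FiniteDimensional F L]

lemma exists_isMinimalGradedIdeal_le {K : LieIdeal F L}
    (hK : IsGradedSubspace 𝒜 K.toSubmodule) (hK0 : K ≠ ⊥) :
    ∃ A ≤ K, IsMinimalGradedIdeal 𝒜 A := by
  have := LieSubmodule.wellFoundedLT_of_isArtinian F L L
  obtain ⟨A, hA, hAmin⟩ := exists_minimal_le_of_wellFoundedLT
    (fun I : LieIdeal F L ↦ IsGradedSubspace 𝒜 I.toSubmodule ∧ I ≠ ⊥) K ⟨hK, hK0⟩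
  exact ⟨A, hA, hAmin⟩

variable [LieAlgebra.IsKilling F L]

/-- An ideal of an ideal `A` of a Lie algebra with nondegenerate Killing form is an ideal. -/
def LieIdeal.mapOfIsKilling (A : LieIdeal F L) (I : LieIdeal F A) : LieIdeal F L where
  toSubmodule := I.toSubmodule.map A.toSubmodule.subtype
  lie_mem := by
    rintro x _ ⟨y, hy, rfl⟩
    obtain ⟨a, ha, b, hb, rfl⟩ : ∃ a ∈ A, ∃ b ∈ A.killingCompl, a + b = x :=
      (LieSubmodule.mem_sup _ _ _).mp (A.isCompl_killingCompl.sup_eq_top ▸ LieSubmodule.mem_top x)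
    have hby : ⁅b, (y : L)⁆ = 0 := by
      have : ⁅b, (y : L)⁆ ∈ A ⊓ A.killingCompl := ⟨lie_mem_right F L A b y y.2,
        lie_mem_left F L A.killingCompl b y hb⟩
      rwa [A.isCompl_killingCompl.inf_eq_bot, LieSubmodule.mem_bot] at this
    refine ⟨⁅(⟨a, ha⟩ : A), y⁆, I.lie_mem hy, ?_⟩
    change ⁅a, (y : L)⁆ = ⁅a + b, (y : L)⁆
    rw [add_lie, hby, add_zero]

lemma IsMinimalGradedIdeal.isGradedSimple {A : LieIdeal F L} (hA : IsMinimalGradedIdeal 𝒜 A) :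
    IsGradedSimple (fun g => ((𝒜 g).comap A.toSubmodule.subtype : Submodule F ↥A)) := by
  refine ⟨?_, fun I hI ↦ ?_⟩
  · by_contra! hab
    have : IsLieAbelian A := ⟨hab⟩
    exact hA.prop.2 (LieAlgebra.IsKilling.ideal_eq_bot_of_isLieAbelian A)
  · have hgr : IsGradedSubspace 𝒜 (A.mapOfIsKilling I).toSubmodule := by
      refine isGradedSubspace_iff_le.mpr ?_
      change I.toSubmodule.map A.toSubmodule.subtype ≤ _
      refine (Submodule.map_mono hI.le).trans ?_
      rw [Submodule.map_iSup]
      refine iSup_mono fun g ↦ ?_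
      rintro _ ⟨y, hy, rfl⟩
      exact ⟨hy.1, y, hy.2, rfl⟩
    have hle : A.mapOfIsKilling I ≤ A := by
      rintro _ ⟨y, -, rfl⟩
      exact y.2
    by_cases hbot : A.mapOfIsKilling I = ⊥
    · left
      refine (LieSubmodule.eq_bot_iff _).mpr fun y hy ↦ Subtype.ext ?_
      have : (y : L) ∈ A.mapOfIsKilling I := ⟨y, hy, rfl⟩
      rwa [hbot, LieSubmodule.mem_bot] at this
    · right
      refine eq_top_iff.mpr fun y _ ↦ ?_
      obtain ⟨z, hz, hzy⟩ := hA.le_of_le ⟨hgr, hbot⟩ hle y.2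
      rwa [← Subtype.ext hzy]

lemma sSupIndep_isMinimalGradedIdeal (h : IsLieGrading 𝒜) :
    sSupIndep {A | IsMinimalGradedIdeal 𝒜 A} := by
  intro A hA
  refine A.isCompl_killingCompl.disjoint.mono_right (sSup_le fun B hB ↦ ?_)
  have hdisj : Disjoint B A := IsMinimalGradedIdeal.disjoint h hB.1 hA hB.2
  calc B = B ⊓ (A ⊔ A.killingCompl) := by rw [A.isCompl_killingCompl.sup_eq_top, inf_top_eq]
    _ = B ⊓ A ⊔ B ⊓ A.killingCompl := inf_sup_left _ _ _
    _ ≤ A.killingCompl := by rw [hdisj.eq_bot, bot_sup_eq]; exact inf_le_right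

lemma sSup_isMinimalGradedIdeal_eq_top (h : IsLieGrading 𝒜) :
    sSup {A | IsMinimalGradedIdeal 𝒜 A} = ⊤ := by
  set J := sSup {A | IsMinimalGradedIdeal 𝒜 A}
  have hJ : IsGradedSubspace 𝒜 J.toSubmodule := by
    exact isGradedSubspace_sSup fun A hA ↦ hA.1.1
  by_contra hJtop
  have hK : J.killingCompl ≠ ⊥ := fun hbot ↦ hJtop <| by
    simpa [hbot] using J.isCompl_killingCompl.sup_eq_top
  obtain ⟨A, hAK, hA⟩ := exists_isMinimalGradedIdeal_le (h.isGradedSubspace_killingCompl hJ) hK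
  exact hA.prop.2 (disjoint_self.mp
    (J.isCompl_killingCompl.disjoint.mono (le_sSup hA) hAK))

end Grading

/-- A finite dimensional semisimple `G`-graded Lie algebra over an
algebraically closed field of characteristic zero is a direct sum of graded ideals, each
graded simple with respect to the induced grading, and the support of each summand is a
commutative subset of `G`. -/
theorem semisimple_graded_decomposition {G F L : Type*} [Group G] [Field F] [IsAlgClosed F]
    [CharZero F] [LieRing L] [LieAlgebra F L] [FiniteDimensional F L]
    (𝒜 : G → Submodule F L) (hgr : IsLieGrading 𝒜)
    (hss : LieAlgebra.radical F L = ⊥) :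
    ∃ (m : ℕ) (A : Fin m → LieIdeal F L),
      DirectSum.IsInternal (fun i => (A i).toSubmodule) ∧
      ∀ i : Fin m,
        IsGradedSubspace 𝒜 (A i).toSubmodule ∧
        IsLieGrading (fun g => ((𝒜 g).comap (A i).toSubmodule.subtype : Submodule F ↥(A i))) ∧
        IsGradedSimple (fun g => ((𝒜 g).comap (A i).toSubmodule.subtype : Submodule F ↥(A i))) ∧
        ∀ g h : G, 𝒜 g ⊓ (A i).toSubmodule ≠ ⊥ → 𝒜 h ⊓ (A i).toSubmodule ≠ ⊥ →
          g * h = h * g := by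
  have : LieAlgebra.HasTrivialRadical F L := ⟨hss⟩
  have hind := sSupIndep_isMinimalGradedIdeal hgr
  have hfin : {A | IsMinimalGradedIdeal 𝒜 A}.Finite := WellFoundedGT.finite_of_sSupIndep hind
  have := hfin.to_subtype
  let e := (Finite.equivFin {A | IsMinimalGradedIdeal 𝒜 A}).symm
  refine ⟨_, fun i ↦ (e i).1, ?_, fun i ↦ ?_⟩
  · rw [DirectSum.isInternal_submodule_iff_iSupIndep_and_iSup_eq_top,
      LieSubmodule.iSupIndep_toSubmodule, LieSubmodule.iSup_toSubmodule_eq_top]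
    refine ⟨((sSupIndep_iff _).mp hind).comp e.injective, ?_⟩
    rw [e.iSup_comp (g := Subtype.val), ← sSup_eq_iSup', sSup_isMinimalGradedIdeal_eq_top hgr]
  · have hA : IsMinimalGradedIdeal 𝒜 (e i).1 := (e i).2
    have hgrA := hgr.comap_subtype hA.prop.1
    refine ⟨hA.prop.1, hgrA, hA.isGradedSimple, fun g k hg hk ↦ ?_⟩
    have hne {g : G} (hg : 𝒜 g ⊓ (e i).1.toSubmodule ≠ ⊥) :
        (𝒜 g).comap (e i).1.toSubmodule.subtype ≠ ⊥ := fun hbot ↦ hg <| by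
      rw [inf_comm, ← Submodule.map_comap_subtype, hbot, Submodule.map_bot]
    exact hA.isGradedSimple.mul_comm_of_ne_bot hgrA (hne hg) (hne hk)
end

section
/- Let G be a finite group, F an algebraically closed field of characteristic zero, and let L = ⊕_{g∈G} L_g be a finite dimensional G-graded Lie algebra over F. Then the solvable radical R = Rad L of L is a graded ideal of L. -/
namespace LieModule

/-- Over an algebraically closed field of characteristic zero, an element of `⁅L, I⁆` with `I` a
solvable ideal acts nilpotently on any finite-dimensional `L`-module, even after composition with
the action of an arbitrary element of `L`. -/
lemma isNilpotent_toEnd_mul_toEnd_lie_of_isSolvable {F L M : Type*} [Field F] [IsAlgClosed F]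
    [CharZero F] [LieRing L] [LieAlgebra F L] [AddCommGroup M] [Module F M] [LieRingModule L M]
    [LieModule F L M] [FiniteDimensional F M] (I : LieIdeal F L) [LieAlgebra.IsSolvable I]
    (a b : L) {r : L} (hr : r ∈ I) :
    _root_.IsNilpotent (toEnd F L M a * toEnd F L M ⁅b, r⁆) := by
  induction hn : Module.finrank F M using Nat.strong_induction_on generalizing M with
  | _ n ih =>
  cases subsingleton_or_nontrivial M with
  | inl h => exact ⟨1, LinearMap.ext fun _ ↦ Subsingleton.elim _ _⟩
  | inr h =>
  obtain ⟨χ, hχ⟩ := exists_nontrivial_weightSpace_of_isSolvable F I M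
  let W : LieSubmodule F L M := weightSpaceOfIsLieTower F M χ
  have hW : Nontrivial W := hχ
  have mem_W (m : M) : m ∈ W ↔ ∀ x : I, ⁅(x : L), m⁆ = χ x • m := mem_weightSpace χ m
  have hz : ⁅b, r⁆ ∈ I := I.lie_mem hr
  have scalar : toEnd F L W ⁅b, r⁆ = χ ⟨_, hz⟩ • 1 := by
    ext ⟨m, hm⟩
    exact (mem_W m).mp hm ⟨_, hz⟩
  have χ_zero : χ ⟨_, hz⟩ = 0 := by
    have htr : LinearMap.trace F W (toEnd F L W ⁅b, r⁆) = 0 :=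
      trace_toEnd_eq_zero_of_mem_lcs F L W le_rfl <| by
        simpa only [lowerCentralSeries_succ, lowerCentralSeries_zero] using
          LieSubmodule.lie_mem_lie (LieSubmodule.mem_top b) (LieSubmodule.mem_top r)
    rw [scalar, map_smul, LinearMap.trace_one, smul_eq_mul, mul_eq_zero] at htr
    exact htr.resolve_right (Nat.cast_ne_zero.mpr Module.finrank_pos.ne')
  have hlt : Module.finrank F (M ⧸ W) < n := by
    have h₁ := W.toSubmodule.finrank_quotient_add_finrank
    have h₂ : 0 < Module.finrank F W := Module.finrank_pos
    change Module.finrank F (M ⧸ W.toSubmodule) < n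
    change 0 < Module.finrank F W.toSubmodule at h₂
    omega
  obtain ⟨k, hk⟩ := ih _ hlt (M := M ⧸ W) rfl
  refine ⟨k + 1, LinearMap.ext fun m ↦ ?_⟩
  set f := toEnd F L M a * toEnd F L M ⁅b, r⁆
  have hmk (j : ℕ) (m : M) : LieSubmodule.Quotient.mk (N := W) ((f ^ j) m) =
      ((toEnd F L (M ⧸ W) a * toEnd F L (M ⧸ W) ⁅b, r⁆) ^ j) (LieSubmodule.Quotient.mk m) := by
    induction j with
    | zero => rfl
    | succ j ihj =>
      rw [pow_succ', pow_succ', Module.End.mul_apply f, Module.End.mul_apply (_ * _), ← ihj]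
      rfl
  have hmem : (f ^ k) m ∈ W := by
    rw [← LieSubmodule.Quotient.mk_eq_zero', hmk, hk, LinearMap.zero_apply]
  have hzero : ⁅⁅b, r⁆, (f ^ k) m⁆ = 0 := by
    simpa [χ_zero] using (mem_W _).mp hmem ⟨_, hz⟩
  rw [pow_succ', Module.End.mul_apply, Module.End.mul_apply, toEnd_apply_apply _ _ _ ⁅b, r⁆, hzero,
    map_zero, LinearMap.zero_apply]

end LieModule

namespace LieAlgebra

/-- In characteristic zero, the solvable radical is the orthogonal complement of the derived ideal
with respect to the Killing form. -/
lemma radical_eq_killingCompl_lie_top (F L : Type*) [Field F] [IsAlgClosed F] [CharZero F]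
    [LieRing L] [LieAlgebra F L] [FiniteDimensional F L] :
    radical F L = LieIdeal.killingCompl F L ⁅(⊤ : LieIdeal F L), (⊤ : LieIdeal F L)⁆ := by
  apply le_antisymm
  · intro r hr
    rw [LieIdeal.mem_killingCompl]
    intro y hy
    change y ∈ (⁅(⊤ : LieIdeal F L), (⊤ : LieIdeal F L)⁆).toSubmodule at hy
    rw [LieSubmodule.lieIdeal_oper_eq_linear_span'] at hy
    induction hy using Submodule.span_induction with
    | mem y hy =>
      obtain ⟨a, -, b, -, rfl⟩ := hy
      rw [LieModule.traceForm_apply_lie_apply, LieModule.traceForm_apply_apply]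
      exact (LinearMap.isNilpotent_trace_of_isNilpotent
        (LieModule.isNilpotent_toEnd_mul_toEnd_lie_of_isSolvable (M := L)
          (radical F L) a b hr)).eq_zero
    | zero => simp
    | add y z _ _ hy hz => simp [hy, hz]
    | smul c y _ hy => simp [hy]
  · rw [← LieIdeal.solvable_iff_le_radical]
    refine LieIdeal.isSolvable_of_killingForm_apply_lie_eq_zero _ fun x hx y hy ↦ ?_
    rw [LieModule.traceForm_comm]
    exact (LieIdeal.mem_killingCompl F L _).mp hx y (LieSubmodule.mono_lie le_top le_top hy)

end LieAlgebra

/-- Homogeneous components of a graded Lie algebra are orthogonal with respect to the Killing form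
unless their degrees are inverse to each other. -/
lemma IsLieGrading.killingForm_eq_zero_s11 {G F L : Type*} [Group G] [Finite G] [Field F] [LieRing L]
    [LieAlgebra F L] [FiniteDimensional F L] {𝒜 : G → Submodule F L} (hgr : IsLieGrading 𝒜)
    {g h : G} (hgh : g * h ≠ 1) {x y : L} (hx : x ∈ 𝒜 g) (hy : y ∈ 𝒜 h) :
    killingForm F L x y = 0 := by
  classical
  have := Fintype.ofFinite G
  rw [killingForm_apply_apply]
  refine LinearMap.trace_eq_zero_of_mapsTo_ne (N := 𝒜) (by convert hgr.1)
    (fun k ↦ g * h * k) (fun k ↦ by simpa using hgh) fun k z hz ↦ ?_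
  rw [mul_assoc]
  exact hgr.2 _ _ x hx _ (hgr.2 _ _ y hy z hz)

/-- If `L` is a finite dimensional Lie algebra over an algebraically closed
field of characteristic zero, graded by a finite group `G`, then the solvable radical of
`L` is a graded ideal. -/
theorem radical_isGraded {G F L : Type*} [Group G] [Finite G] [Field F] [IsAlgClosed F]
    [CharZero F] [LieRing L] [LieAlgebra F L] [FiniteDimensional F L]
    (𝒜 : G → Submodule F L) (hgr : IsLieGrading 𝒜) :
    IsGradedSubspace 𝒜 (LieAlgebra.radical F L).toSubmodule := by
  classical
  have := Fintype.ofFinite G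
  refine le_antisymm (fun x hx ↦ ?_) (iSup_le fun g ↦ inf_le_right)
  have htop : (⨆ g, 𝒜 g) = ⊤ := hgr.1.submodule_iSup_eq_top
  obtain ⟨c, rfl⟩ : ∃ c : (g : G) → 𝒜 g, ∑ g, (c g : L) = x :=
    (Submodule.mem_iSup_finset_iff_exists_sum 𝒜 x).mp (by simp [htop])
  rw [LieAlgebra.radical_eq_killingCompl_lie_top] at hx ⊢
  refine Submodule.sum_mem _ fun g _ ↦ Submodule.mem_iSup_of_mem g ⟨(c g).2, ?_⟩
  have hom {h k : G} {u v : L} (hu : u ∈ 𝒜 h) (hv : v ∈ 𝒜 k) :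
      killingForm F L ⁅u, v⁆ (c g) = 0 := by
    have huv := hgr.2 h k u hu v hv
    by_cases hhk : h * k * g = 1
    · have hsum := (LieIdeal.mem_killingCompl F L _).mp hx ⁅u, v⁆
        (LieSubmodule.lie_mem_lie (LieSubmodule.mem_top u) (LieSubmodule.mem_top v))
      rwa [map_sum, Finset.sum_eq_single g ?_ (by simp)] at hsum
      intro g' _ hg'
      refine hgr.killingForm_eq_zero_s11 (fun h' ↦ hg' ?_) huv (c g').2
      exact mul_left_cancel (h'.trans hhk.symm)
    · exact hgr.killingForm_eq_zero_s11 hhk huv (c g).2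
  have all (u v : L) : killingForm F L ⁅u, v⁆ (c g) = 0 := by
    have hu : u ∈ ⨆ g, 𝒜 g := htop ▸ Submodule.mem_top
    have hv : v ∈ ⨆ g, 𝒜 g := htop ▸ Submodule.mem_top
    induction hu using Submodule.iSup_induction' with
    | mem h u hu =>
      induction hv using Submodule.iSup_induction' with
      | mem k v hv => exact hom hu hv
      | zero => simp
      | add v w _ _ hv hw => simp [hv, hw]
    | zero => simp
    | add u w _ _ hu hw => simp [hu, hw]
  change (c g : L) ∈ LieIdeal.killingCompl F L _
  rw [LieIdeal.mem_killingCompl]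
  intro y hy
  change y ∈ (⁅(⊤ : LieIdeal F L), (⊤ : LieIdeal F L)⁆).toSubmodule at hy
  rw [LieSubmodule.lieIdeal_oper_eq_linear_span'] at hy
  induction hy using Submodule.span_induction with
  | mem y hy =>
    obtain ⟨a, -, b, -, rfl⟩ := hy
    exact all a b
  | zero => simp
  | add y z _ _ hy hz => simp [hy, hz]
  | smul c y _ hy => simp [hy]
end

section
/- Let G be a finite group, F an algebraically closed field of characteristic zero, and let L = ⊕_{g∈G} L_g be a finite dimensional G-graded Lie algebra over F with solvable radical R = Rad L. Then there exists a Levi subalgebra B of L (a maximal semisimple subalgebra with L = B ⊕ R as vector spaces) that is a graded subspace of L; i.e., L is a split extension L = B + R with B homogeneous in the G-grading. -/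
section Perfect

variable {F S V : Type*} [Field F] [LieRing S] [LieAlgebra F S] [AddCommGroup V] [Module F V]
  [LieRingModule S V] [LieModule F S V]

theorem LieAlgebra.IsKilling.lie_top_top_eq_top [LieAlgebra.IsKilling F S]
    [FiniteDimensional F S] : ⁅(⊤ : LieIdeal F S), (⊤ : LieIdeal F S)⁆ = ⊤ := by
  set D : LieIdeal F S := ⁅(⊤ : LieIdeal F S), (⊤ : LieIdeal F S)⁆ with hD
  have hbot : D.killingCompl = ⊥ := by
    rw [eq_bot_iff]
    intro x hx
    rw [LieIdeal.mem_killingCompl] at hx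
    have hcenter : x ∈ LieAlgebra.center F S := by
      intro y
      refine (LieAlgebra.IsKilling.killingForm_nondegenerate F S).1 _ fun z ↦ ?_
      have h1 : ⁅y, z⁆ ∈ D := LieSubmodule.lie_mem_lie (LieSubmodule.mem_top y)
        (LieSubmodule.mem_top z)
      have h2 := hx _ h1
      rw [LieModule.traceForm_comm] at h2
      rw [← lie_skew, map_neg, LinearMap.neg_apply, LieModule.traceForm_apply_lie_apply, h2,
        neg_zero]
    have : LieAlgebra.center F S = ⊥ := by simp
    rwa [this] at hcenter
  have hc := LieIdeal.isCompl_killingCompl D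
  rw [hbot] at hc
  exact eq_top_of_isCompl_bot hc

theorem LieModule.lie_eq_zero_of_isNilpotent_of_perfect [LieModule.IsNilpotent S V]
    (hS : ⁅(⊤ : LieIdeal F S), (⊤ : LieIdeal F S)⁆ = ⊤) (x : S) (v : V) : ⁅x, v⁆ = 0 := by
  have key : ∀ k (x : S) (v : V), ⁅x, v⁆ ∈ LieModule.lowerCentralSeries F S V k := by
    intro k
    induction k with
    | zero => intro x v; simp
    | succ k ih =>
      intro x v
      rw [LieModule.lowerCentralSeries_succ]
      have hx : x ∈ (⁅(⊤ : LieIdeal F S), (⊤ : LieIdeal F S)⁆ : LieIdeal F S) := by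
        rw [hS]; trivial
      rw [← LieSubmodule.mem_toSubmodule, LieSubmodule.lieIdeal_oper_eq_linear_span'] at hx
      induction hx using Submodule.span_induction with
      | mem x hx =>
        obtain ⟨a, -, b, -, rfl⟩ := hx
        rw [lie_lie]
        exact sub_mem (LieSubmodule.lie_mem_lie (LieSubmodule.mem_top _) (ih _ _))
          (LieSubmodule.lie_mem_lie (LieSubmodule.mem_top _) (ih _ _))
      | zero => simp
      | add x y _ _ hx hy => rw [add_lie]; exact add_mem hx hy
      | smul c x _ hx => rw [smul_lie]; exact Submodule.smul_mem _ c hx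
  obtain ⟨k, hk⟩ := (LieModule.isNilpotent_iff F S V).mp ‹_›
  have := key k x v
  rwa [hk, LieSubmodule.mem_bot] at this

theorem LieModule.lie_eq_zero_of_traceForm_eq_zero [CharZero F] [LieAlgebra.IsKilling F S]
    [FiniteDimensional F S] [FiniteDimensional F V]
    (h : LieModule.traceForm F S V = 0) (x : S) (v : V) : ⁅x, v⁆ = 0 := by
  have hp := LieAlgebra.IsKilling.lie_top_top_eq_top (F := F) (S := S)
  have hn := LieModule.isNilpotent_derivedSeries_of_traceForm_eq_zero h
  have : LieModule.IsNilpotent S V := by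
    rw [LieModule.isNilpotent_iff_forall' (R := F)] at hn ⊢
    intro y
    refine hn ⟨y, ?_⟩
    rw [LieAlgebra.derivedSeries_def, LieAlgebra.derivedSeriesOfIdeal_succ,
      LieAlgebra.derivedSeriesOfIdeal_zero, hp]
    trivial
  exact LieModule.lie_eq_zero_of_isNilpotent_of_perfect hp x v

/-- The Casimir element: a finite dimensional module on which a Lie algebra with nondegenerate
Killing form acts nontrivially has an equivariant endomorphism, built from the action, whose
trace does not vanish. -/
theorem LieModule.exists_casimir [CharZero F] [LieAlgebra.IsKilling F S]
    [FiniteDimensional F S] [FiniteDimensional F V]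
    (h : LieModule.traceForm F S V ≠ 0) :
    ∃ c : Module.End F V, (∀ (x : S) (v : V), c ⁅x, v⁆ = ⁅x, c v⁆) ∧
      (∀ v, c v ∈ Submodule.span F {w : V | ∃ (x : S) (u : V), ⁅x, u⁆ = w}) ∧
      LinearMap.trace F V c ≠ 0 := by
  set τ := LieModule.traceForm F S V with hτ
  let K : LieIdeal F S :=
    { LinearMap.ker τ with
      lie_mem := by
        intro x m hm
        change τ m = 0 at hm
        change τ ⁅x, m⁆ = 0
        ext y
        rw [← lie_skew, map_neg, LinearMap.neg_apply, hτ, LieModule.traceForm_apply_lie_apply,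
          ← hτ, hm]
        simp }
  have memK : ∀ x, x ∈ K ↔ τ x = 0 := fun x ↦ Iff.rfl
  set J : LieIdeal F S := K.killingCompl with hJ
  have hKJ : IsCompl K J := LieIdeal.isCompl_killingCompl K
  have hdec : ∀ x : S, ∃ k ∈ K, ∃ j ∈ J, k + j = x := by
    intro x
    have : x ∈ K ⊔ J := by rw [hKJ.sup_eq_top]; trivial
    exact (LieSubmodule.mem_sup K J x).mp this
  have hJ0 : J ≠ ⊥ := by
    intro h0
    rw [h0] at hKJ
    have hK := eq_top_of_isCompl_bot hKJ
    apply h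
    ext x y
    have hx : x ∈ K := by rw [hK]; trivial
    rw [(memK x).mp hx]
    rfl
  -- the restriction of the trace form to `J`
  let B : LinearMap.BilinForm F J := τ.compl₁₂ J.toSubmodule.subtype J.toSubmodule.subtype
  have hBap : ∀ a b : J, B a b = τ a b := fun a b ↦ rfl
  have hBsymm : B.IsSymm := ⟨fun a b ↦ by
    simp only [hBap]
    exact LieModule.traceForm_comm F S V _ _⟩
  have hBnd : B.Nondegenerate := by
    refine hBsymm.isRefl.nondegenerate_iff_separatingLeft.mpr ?_
    intro a ha
    have : (a : S) ∈ K := by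
      rw [memK]
      ext y
      obtain ⟨k, hk, j, hj, rfl⟩ := hdec y
      have h1 : τ a j = 0 := ha ⟨j, hj⟩
      have h2 : τ a k = 0 := by
        rw [hτ, LieModule.traceForm_comm, ← hτ, (memK k).mp hk]; rfl
      simp [h1, h2]
    have h3 : (a : S) ∈ K ⊓ J := ⟨this, a.2⟩
    rw [hKJ.inf_eq_bot, LieSubmodule.mem_bot] at h3
    exact Subtype.ext h3
  let b := Module.finBasis F J
  let b' := B.dualBasis hBnd b
  have hbb' : ∀ i j, τ (b' i) (b j) = if j = i then 1 else 0 := fun i j ↦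
    B.apply_dualBasis_left hBnd b i j
  have hb'b : ∀ i j, τ (b i) (b' j) = if i = j then 1 else 0 := fun i j ↦ by
    rw [hτ, LieModule.traceForm_comm, ← hτ, hbb']
  have exp_b : ∀ x ∈ J, x = ∑ i, τ x (b' i) • (b i : S) := by
    intro x hx
    have h1 := b.sum_repr ⟨x, hx⟩
    have h2 := congrArg (Subtype.val) h1
    have h3 : x = ∑ i, b.repr ⟨x, hx⟩ i • (b i : S) := by
      conv_lhs => rw [show x = ((⟨x, hx⟩ : J) : S) from rfl, ← h1]
      exact map_sum J.toSubmodule.subtype _ _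
    have h4 : ∀ i, τ x (b' i) = b.repr ⟨x, hx⟩ i := by
      intro i
      conv_lhs => rw [h3]
      simp [hb'b]
    simp only [h4]
    exact h3
  have exp_b' : ∀ x ∈ J, x = ∑ i, τ x (b i) • (b' i : S) := by
    intro x hx
    have h1 := b'.sum_repr ⟨x, hx⟩
    have h3 : x = ∑ i, b'.repr ⟨x, hx⟩ i • (b' i : S) := by
      conv_lhs => rw [show x = ((⟨x, hx⟩ : J) : S) from rfl, ← h1]
      exact map_sum J.toSubmodule.subtype _ _
    have h4 : ∀ i, τ x (b i) = b'.repr ⟨x, hx⟩ i := by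
      intro i
      conv_lhs => rw [h3]
      simp [hbb']
    simp only [h4]
    exact h3
  let ρ := LieModule.toEnd F S V
  let c : Module.End F V := ∑ i, ρ (b i) ∘ₗ ρ (b' i)
  have hc : ∀ v, c v = ∑ i, ⁅(b i : S), ⁅(b' i : S), v⁆⁆ := by
    intro v
    simp [c, ρ]
  refine ⟨c, ?_, ?_, ?_⟩
  · intro x v
    rw [hc, hc, lie_sum]
    have h1 : ∀ i, ⁅x, ⁅(b i : S), ⁅(b' i : S), v⁆⁆⁆ = ⁅(b i : S), ⁅(b' i : S), ⁅x, v⁆⁆⁆ +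
        (⁅⁅x, (b i : S)⁆, ⁅(b' i : S), v⁆⁆ + ⁅(b i : S), ⁅⁅x, (b' i : S)⁆, v⁆⁆) := by
      intro i
      rw [leibniz_lie x (b i : S), leibniz_lie x (b' i : S), lie_add]
      abel
    simp only [h1]
    rw [Finset.sum_add_distrib, left_eq_add, Finset.sum_add_distrib]
    have h2 : ∀ i, ⁅⁅x, (b i : S)⁆, ⁅(b' i : S), v⁆⁆ =
        ∑ j, τ ⁅x, (b i : S)⁆ (b' j) • ⁅(b j : S), ⁅(b' i : S), v⁆⁆ := by
      intro i
      conv_lhs => rw [exp_b ⁅x, (b i : S)⁆ (lie_mem_right F S J _ _ (b i).2)]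
      rw [sum_lie]
      simp only [smul_lie]
    have h3 : ∀ i, ⁅(b i : S), ⁅⁅x, (b' i : S)⁆, v⁆⁆ =
        ∑ j, τ ⁅x, (b' i : S)⁆ (b j) • ⁅(b i : S), ⁅(b' j : S), v⁆⁆ := by
      intro i
      conv_lhs => rw [exp_b' ⁅x, (b' i : S)⁆ (lie_mem_right F S J _ _ (b' i).2)]
      rw [sum_lie, lie_sum]
      simp only [smul_lie, lie_smul]
    simp only [h2, h3]
    rw [Finset.sum_comm, ← Finset.sum_add_distrib]
    refine Finset.sum_eq_zero fun i _ ↦ ?_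
    rw [← Finset.sum_add_distrib]
    refine Finset.sum_eq_zero fun j _ ↦ ?_
    rw [← add_smul]
    have : τ ⁅x, (b j : S)⁆ (b' i) + τ ⁅x, (b' i : S)⁆ (b j) = 0 := by
      rw [← lie_skew x (b j : S), map_neg, LinearMap.neg_apply, hτ,
        LieModule.traceForm_apply_lie_apply, LieModule.traceForm_comm, neg_add_cancel]
    rw [this, zero_smul]
  · intro v
    rw [hc]
    exact sum_mem fun i _ ↦ Submodule.subset_span ⟨_, _, rfl⟩
  · have h1 : LinearMap.trace F V c = ∑ i, τ (b i) (b' i) := by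
      simp only [c, map_sum]
      rfl
    rw [h1]
    simp only [hb'b, if_true]
    simp only [Finset.sum_const, Finset.card_univ, Fintype.card_fin, nsmul_eq_mul, mul_one]
    rw [Nat.cast_ne_zero]
    intro h0
    apply hJ0
    rw [← LieSubmodule.toSubmodule_eq_bot]
    exact Submodule.finrank_eq_zero.mp h0

end Perfect

section Invariants

universe w

/-- The splitting form of Weyl's theorem: an extension of a trivial one dimensional module over a
semisimple Lie algebra splits. -/
theorem LieModule.exists_forall_lie_eq_zero_of_functional {F S : Type*} [Field F] [CharZero F]
    [LieRing S] [LieAlgebra F S] [LieAlgebra.IsKilling F S] [FiniteDimensional F S] (n : ℕ) :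
    ∀ (V : Type w) [AddCommGroup V] [Module F V] [LieRingModule S V] [LieModule F S V]
      [FiniteDimensional F V], Module.finrank F V = n →
      ∀ φ : V →ₗ[F] F, φ ≠ 0 → (∀ (x : S) (v : V), φ ⁅x, v⁆ = 0) →
      ∃ v : V, φ v ≠ 0 ∧ ∀ x : S, ⁅x, v⁆ = 0 := by
  induction n using Nat.strong_induction_on with
  | _ n ih =>
  intro V _ _ _ _ _ hn φ hφ hφ0
  by_cases hτ : LieModule.traceForm F S V = 0
  · obtain ⟨v, hv⟩ : ∃ v, φ v ≠ 0 := by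
      by_contra! h
      exact hφ (LinearMap.ext h)
    exact ⟨v, hv, fun x ↦ LieModule.lie_eq_zero_of_traceForm_eq_zero hτ x v⟩
  obtain ⟨c, hc, hcr, hct⟩ := LieModule.exists_casimir hτ
  have hφc : ∀ v, φ (c v) = 0 := by
    intro v
    have : Submodule.span F {w : V | ∃ (x : S) (u : V), ⁅x, u⁆ = w} ≤ LinearMap.ker φ := by
      rw [Submodule.span_le]
      rintro _ ⟨x, u, rfl⟩
      exact hφ0 x u
    exact this (hcr v)
  obtain ⟨k, hk1, hk⟩ := ((Filter.eventually_ge_atTop 1).and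
    (LinearMap.eventually_isCompl_ker_pow_range_pow c)).exists
  have hck : ∀ (m : ℕ) (x : S) (v : V), (c ^ m) ⁅x, v⁆ = ⁅x, (c ^ m) v⁆ := by
    intro m x v
    induction m with
    | zero => simp
    | succ m ihm => rw [pow_succ', Module.End.mul_apply, Module.End.mul_apply, ihm, hc]
  let N : LieSubmodule F S V :=
    { LinearMap.ker (c ^ k) with
      lie_mem := by
        intro x m hm
        change (c ^ k) m = 0 at hm
        change (c ^ k) ⁅x, m⁆ = 0
        rw [hck, hm, lie_zero] }
  have hNtop : LinearMap.ker (c ^ k) ≠ ⊤ := by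
    intro h
    rw [LinearMap.ker_eq_top] at h
    exact hct (LinearMap.isNilpotent_trace_of_isNilpotent ⟨k, h⟩).eq_zero
  have hlt : Module.finrank F N < n := by
    rw [← hn]
    exact Submodule.finrank_lt hNtop
  have hφN : φ ∘ₗ N.toSubmodule.subtype ≠ 0 := by
    intro h
    apply hφ
    ext v
    have hv : v ∈ LinearMap.ker (c ^ k) ⊔ LinearMap.range (c ^ k) := by
      rw [hk.sup_eq_top]; trivial
    obtain ⟨a, ha, _, ⟨b, rfl⟩, rfl⟩ := Submodule.mem_sup.mp hv
    have h1 : φ a = 0 := LinearMap.congr_fun h ⟨a, ha⟩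
    obtain ⟨m, rfl⟩ := Nat.exists_eq_add_of_le' hk1
    rw [map_add, h1, pow_succ', Module.End.mul_apply, hφc]
    simp
  obtain ⟨v, hv, hv0⟩ := ih _ hlt N rfl (φ ∘ₗ N.toSubmodule.subtype) hφN
    (fun x v ↦ hφ0 x v)
  exact ⟨v, hv, fun x ↦ congrArg Subtype.val (hv0 x)⟩

/-- Relative version: if the kernel of a surjection `p` onto a semisimple Lie algebra maps a
module `V` into a submodule `P`, then a functional vanishing on `P` and on all brackets
is nonzero at some vector which is invariant modulo `P`. -/
theorem LieModule.exists_forall_lie_mem_of_functional {F S L V : Type*} [Field F] [CharZero F]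
    [LieRing S] [LieAlgebra F S] [LieAlgebra.IsKilling F S] [FiniteDimensional F S]
    [LieRing L] [LieAlgebra F L] [AddCommGroup V] [Module F V] [LieRingModule L V]
    [LieModule F L V] [FiniteDimensional F V]
    (p : L →ₗ⁅F⁆ S) (hp : Function.Surjective p) (P : LieSubmodule F L V)
    (hP : ∀ x, p x = 0 → ∀ v : V, ⁅x, v⁆ ∈ P)
    (φ : V →ₗ[F] F) (hφ : φ ≠ 0) (hφ0 : ∀ (x : L) (v : V), φ ⁅x, v⁆ = 0)
    (hφP : ∀ v ∈ P, φ v = 0) :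
    ∃ v : V, φ v ≠ 0 ∧ ∀ x : L, ⁅x, v⁆ ∈ P := by
  obtain ⟨s, hs⟩ := (p : L →ₗ[F] S).exists_rightInverse_of_surjective
    (LinearMap.range_eq_top.mpr hp)
  have hps : ∀ a, p (s a) = a := fun a ↦ LinearMap.congr_fun hs a
  have hker : ∀ x, p x = 0 → ∀ v : V ⧸ P, ⁅x, v⁆ = 0 := by
    intro x hx v
    obtain ⟨v, rfl⟩ := LieSubmodule.Quotient.surjective_mk' P v
    rw [← LieModuleHom.map_lie]
    exact (LieSubmodule.Quotient.mk_eq_zero _).mpr (hP x hx v)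
  have heq : ∀ x y, p x = p y → ∀ v : V ⧸ P, ⁅x, v⁆ = ⁅y, v⁆ := by
    intro x y hxy v
    rw [← sub_eq_zero, ← sub_lie]
    exact hker _ (by rw [map_sub, hxy, sub_self]) v
  let _ : LieRingModule S (V ⧸ P) :=
    { bracket := fun a v ↦ ⁅s a, v⁆
      add_lie := fun a b v ↦ by
        rw [map_add, add_lie]
      lie_add := fun a v w ↦ lie_add (s a) v w
      leibniz_lie := fun a b v ↦ by
        change ⁅s a, ⁅s b, v⁆⁆ = ⁅s ⁅a, b⁆, v⁆ + ⁅s b, ⁅s a, v⁆⁆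
        rw [heq (s ⁅a, b⁆) ⁅s a, s b⁆ (by rw [LieHom.map_lie, hps, hps, hps]), lie_lie]
        abel }
  have hdef : ∀ (a : S) (v : V ⧸ P), ⁅a, v⁆ = ⁅s a, v⁆ := fun _ _ ↦ rfl
  let _ : LieModule F S (V ⧸ P) :=
    { smul_lie := fun t a v ↦ by rw [hdef, hdef, map_smul, smul_lie]
      lie_smul := fun t a v ↦ by rw [hdef, hdef, lie_smul] }
  have hact : ∀ (x : L) (v : V ⧸ P), ⁅p x, v⁆ = ⁅x, v⁆ := by
    intro x v
    rw [hdef]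
    exact heq _ _ (hps _) v
  let ψ : (V ⧸ P) →ₗ[F] F := P.toSubmodule.liftQ φ hφP
  have hψ : ∀ v : V, ψ (LieSubmodule.Quotient.mk' P v) = φ v := fun v ↦ rfl
  have hψ0 : ψ ≠ 0 := by
    intro h
    apply hφ
    ext v
    rw [← hψ, h]
    rfl
  obtain ⟨v, hv, hv0⟩ := LieModule.exists_forall_lie_eq_zero_of_functional (S := S) _ (V ⧸ P) rfl
    ψ hψ0 (by
      intro a v
      obtain ⟨x, rfl⟩ := hp a
      obtain ⟨v, rfl⟩ := LieSubmodule.Quotient.surjective_mk' P v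
      rw [hact, ← LieModuleHom.map_lie, hψ, hφ0])
  obtain ⟨v, rfl⟩ := LieSubmodule.Quotient.surjective_mk' P v
  refine ⟨v, by rwa [hψ] at hv, fun x ↦ ?_⟩
  have := hv0 (p x)
  rw [hact, ← LieModuleHom.map_lie] at this
  exact (LieSubmodule.Quotient.mk_eq_zero _).mp this

/-- If the kernel `R` of a surjection onto a semisimple Lie algebra is abelian, there is a linear
retraction onto `R` which commutes with the adjoint action modulo inner derivations from `R`. -/
theorem LieHom.exists_retraction_ker_of_abelian {F S L : Type*} [Field F] [CharZero F]
    [LieRing S] [LieAlgebra F S] [LieAlgebra.IsKilling F S] [FiniteDimensional F S]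
    [LieRing L] [LieAlgebra F L] [FiniteDimensional F L]
    (p : L →ₗ⁅F⁆ S) (hp : Function.Surjective p)
    (hab : ∀ x y : L, p x = 0 → p y = 0 → ⁅x, y⁆ = 0) :
    ∃ f : L →ₗ[F] L, (∀ x, p (f x) = 0) ∧ (∀ x, p x = 0 → f x = x) ∧
      ∀ x : L, ∃ r : L, p r = 0 ∧ ∀ y : L, ⁅x, f y⁆ - f ⁅x, y⁆ = ⁅r, y⁆ := by
  by_cases hR : ∀ r, p r = 0 → r = 0
  · exact ⟨0, by simp, fun x hx ↦ (hR x hx).symm, fun x ↦ ⟨0, by simp, by simp⟩⟩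
  push Not at hR
  obtain ⟨r₀, hr₀, hr₀'⟩ := hR
  obtain ⟨ℓ, hℓ⟩ : ∃ ℓ : Module.Dual F L, ℓ r₀ ≠ 0 := by
    by_contra! h
    exact hr₀' ((Module.forall_dual_apply_eq_zero_iff F r₀).mp h)
  have hlie : ∀ x r : L, p r = 0 → p ⁅x, r⁆ = 0 := by
    intro x r hr
    rw [LieHom.map_lie, hr, lie_zero]
  let W : LieSubmodule F L (L →ₗ[F] L) :=
    { carrier := {f | (∀ x, p (f x) = 0) ∧ ∃ t : F, ∀ r, p r = 0 → f r = t • r}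
      add_mem' := by
        rintro f g ⟨hf, t, ht⟩ ⟨hg, u, hu⟩
        refine ⟨fun x ↦ by simp [hf, hg], t + u, fun r hr ↦ ?_⟩
        rw [LinearMap.add_apply, ht r hr, hu r hr, add_smul]
      zero_mem' := ⟨by simp, 0, by simp⟩
      smul_mem' := by
        rintro a f ⟨hf, t, ht⟩
        refine ⟨fun x ↦ by simp [hf], a * t, fun r hr ↦ ?_⟩
        rw [LinearMap.smul_apply, ht r hr, mul_smul]
      lie_mem := by
        rintro x f ⟨hf, t, ht⟩
        refine ⟨fun y ↦ ?_, 0, fun r hr ↦ ?_⟩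
        · rw [LieHom.lie_apply, map_sub, hf, hlie _ _ (hf y), sub_zero]
        · rw [LieHom.lie_apply, ht r hr, ht _ (hlie x r hr), lie_smul, sub_self, zero_smul] }
  have hW : ∀ f : L →ₗ[F] L, f ∈ W ↔
    (∀ x, p (f x) = 0) ∧ ∃ t : F, ∀ r, p r = 0 → f r = t • r := fun f ↦ Iff.rfl
  let P : LieSubmodule F L W :=
    { carrier := {f | ∃ r, p r = 0 ∧ ∀ y, (f : L →ₗ[F] L) y = ⁅r, y⁆}
      add_mem' := by
        rintro f g ⟨r, hr, hf⟩ ⟨u, hu, hg⟩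
        exact ⟨r + u, by simp [hr, hu], fun y ↦ by simp [hf, hg]⟩
      zero_mem' := ⟨0, by simp, by simp⟩
      smul_mem' := by
        rintro a f ⟨r, hr, hf⟩
        exact ⟨a • r, by simp [hr], fun y ↦ by simp [hf]⟩
      lie_mem := by
        rintro x f ⟨r, hr, hf⟩
        refine ⟨⁅x, r⁆, hlie x r hr, fun y ↦ ?_⟩
        rw [LieSubmodule.coe_bracket, LieHom.lie_apply, hf, hf, lie_lie] }
  let φ : W →ₗ[F] F := ℓ ∘ₗ LinearMap.applyₗ r₀ ∘ₗ W.toSubmodule.subtype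
  have hφ : ∀ f : W, φ f = ℓ ((f : L →ₗ[F] L) r₀) := fun f ↦ rfl
  obtain ⟨q, hq⟩ := (LinearMap.ker (p : L →ₗ[F] S)).subtype.exists_leftInverse_of_injective
    (Submodule.ker_subtype _)
  let f₀ : L →ₗ[F] L := (LinearMap.ker (p : L →ₗ[F] S)).subtype ∘ₗ q
  have hf₀ : ∀ r, p r = 0 → f₀ r = r := fun r hr ↦
    congrArg Subtype.val (LinearMap.congr_fun hq ⟨r, hr⟩)
  have hf₀W : f₀ ∈ W := ⟨fun x ↦ (q x).2, 1, fun r hr ↦ by rw [hf₀ r hr, one_smul]⟩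
  have hne : φ ≠ 0 := by
    intro h
    have h1 : φ ⟨f₀, hf₀W⟩ = 0 := by rw [h]; rfl
    rw [hφ] at h1
    change ℓ (f₀ r₀) = 0 at h1
    rw [hf₀ r₀ hr₀] at h1
    exact hℓ h1
  obtain ⟨⟨f, hfp, t, hft⟩, hf, hfP⟩ := LieModule.exists_forall_lie_mem_of_functional p hp P
    (by
      rintro x hx ⟨f, hf, t, ht⟩
      refine ⟨-(t • x), by simp [hx], fun y ↦ ?_⟩
      rw [LieSubmodule.coe_bracket, LieHom.lie_apply, hab x _ hx (hf y),
        ht _ (by rw [LieHom.map_lie, hx, zero_lie]), zero_sub, neg_lie, smul_lie])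
    φ hne
    (by
      rintro x ⟨f, hf, t, ht⟩
      rw [hφ, LieSubmodule.coe_bracket, LieHom.lie_apply, ht _ hr₀, ht _ (hlie x _ hr₀), lie_smul,
        sub_self, map_zero])
    (by
      rintro ⟨f, hf⟩ ⟨r, hr, hfr⟩
      rw [hφ, hfr, hab _ _ hr hr₀, map_zero])
  have ht0 : t ≠ 0 := by
    rintro rfl
    apply hf
    rw [hφ]
    change ℓ (f r₀) = 0
    rw [hft _ hr₀, zero_smul, map_zero]
  refine ⟨t⁻¹ • f, fun x ↦ by simp [hfp], fun x hx ↦ ?_, fun x ↦ ?_⟩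
  · rw [LinearMap.smul_apply, hft x hx, smul_smul, inv_mul_cancel₀ ht0, one_smul]
  · obtain ⟨r, hr, hrf⟩ := hfP x
    refine ⟨t⁻¹ • r, by simp [hr], fun y ↦ ?_⟩
    have h1 := hrf y
    rw [LieSubmodule.coe_bracket, LieHom.lie_apply] at h1
    change ⁅x, f y⁆ - f ⁅x, y⁆ = ⁅r, y⁆ at h1
    rw [LinearMap.smul_apply, LinearMap.smul_apply, lie_smul, ← smul_sub, h1, smul_lie]

end Invariants

section Grading

/-- The projections of a `G`-graded Lie algebra to its homogeneous components. -/
structure IsLieGradingProj {G F L : Type*} [Group G] [Fintype G] [Field F] [LieRing L]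
    [LieAlgebra F L] (π : G → L →ₗ[F] L) : Prop where
  sum_apply : ∀ x, ∑ g, π g x = x
  apply_self : ∀ g x, π g (π g x) = π g x
  apply_of_ne : ∀ g h x, g ≠ h → π g (π h x) = 0
  apply_lie : ∀ g h x y, π (g * h) ⁅π g x, π h y⁆ = ⁅π g x, π h y⁆

namespace IsLieGradingProj

variable {G F L : Type*} [Group G] [Fintype G] [Field F] [LieRing L]
    [LieAlgebra F L] {π : G → L →ₗ[F] L}

theorem apply_lie_of_ne (hπ : IsLieGradingProj π) {k g h : G} (hk : k ≠ g * h) (x y : L) :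
    π k ⁅π g x, π h y⁆ = 0 := by
  rw [← hπ.apply_lie, hπ.apply_of_ne _ _ _ hk]

theorem apply_lie_left (hπ : IsLieGradingProj π) (g k : G) (x y : L) :
    π (g * k) ⁅π g x, y⁆ = ⁅π g x, π k y⁆ := by
  conv_lhs => rw [← hπ.sum_apply y, lie_sum, map_sum]
  rw [Finset.sum_eq_single k, hπ.apply_lie]
  · intro h _ hk
    exact hπ.apply_lie_of_ne (fun h' ↦ hk (mul_left_cancel h').symm) x y
  · simp

theorem apply_lie_right (hπ : IsLieGradingProj π) (k h : G) (x y : L) :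
    π (k * h) ⁅x, π h y⁆ = ⁅π k x, π h y⁆ := by
  conv_lhs => rw [← hπ.sum_apply x, sum_lie, map_sum]
  rw [Finset.sum_eq_single k, hπ.apply_lie]
  · intro g _ hk
    exact hπ.apply_lie_of_ne (fun h' ↦ hk (mul_right_cancel h').symm) x y
  · simp

theorem killingForm_eq_zero [FiniteDimensional F L] (hπ : IsLieGradingProj π) {g h : G}
    (hgh : g * h ≠ 1) (x y : L) : killingForm F L (π g x) (π h y) = 0 := by
  rw [LieModule.traceForm_apply_apply]
  set T : Module.End F L := LieModule.toEnd F L L (π g x) ∘ₗ LieModule.toEnd F L L (π h y) with hT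
  have hTap : ∀ z, T z = ⁅π g x, ⁅π h y, z⁆⁆ := fun z ↦ rfl
  have h1 : T = ∑ m, (T * π m) * π m := by
    ext z
    conv_lhs => rw [← hπ.sum_apply z, map_sum]
    simp [hπ.apply_self]
  have h2 : ∀ m, π m * (T * π m) = 0 := by
    intro m
    ext z
    rw [Module.End.mul_apply, Module.End.mul_apply, hTap, ← hπ.apply_lie h m,
      LinearMap.zero_apply]
    refine hπ.apply_lie_of_ne (fun h' ↦ hgh ?_) _ _
    rw [← mul_assoc] at h'
    exact (mul_eq_right.mp h'.symm)
  rw [h1, map_sum]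
  refine Finset.sum_eq_zero fun m _ ↦ ?_
  rw [LinearMap.trace_mul_comm, h2, map_zero]

theorem apply_mem_killingCompl_top [FiniteDimensional F L] (hπ : IsLieGradingProj π) (g : G)
    {x : L} (hx : x ∈ LieIdeal.killingCompl F L ⊤) : π g x ∈ LieIdeal.killingCompl F L ⊤ := by
  rw [LieIdeal.mem_killingCompl] at hx ⊢
  intro y _
  have h1 : killingForm F L y (π g x) = killingForm F L (π g⁻¹ y) (π g x) := by
    conv_lhs => rw [← hπ.sum_apply y, map_sum, LinearMap.sum_apply]
    refine Finset.sum_eq_single _ (fun h _ hh ↦ ?_) (by simp)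
    exact hπ.killingForm_eq_zero (fun h' ↦ hh (eq_inv_of_mul_eq_one_left h')) _ _
  have h2 : killingForm F L (π g⁻¹ y) x = killingForm F L (π g⁻¹ y) (π g x) := by
    conv_lhs => rw [← hπ.sum_apply x, map_sum]
    refine Finset.sum_eq_single _ (fun h _ hh ↦ ?_) (by simp)
    refine hπ.killingForm_eq_zero (fun h' ↦ hh ?_) _ _
    rw [inv_mul_eq_one] at h'
    exact h'.symm
  rw [h1, ← h2]
  exact hx _ (LieSubmodule.mem_top _)

theorem apply_mem_lie (hπ : IsLieGradingProj π) {I J : LieIdeal F L}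
    (hI : ∀ g, ∀ x ∈ I, π g x ∈ I) (hJ : ∀ g, ∀ x ∈ J, π g x ∈ J) (g : G) {x : L}
    (hx : x ∈ (⁅I, J⁆ : LieIdeal F L)) : π g x ∈ (⁅I, J⁆ : LieIdeal F L) := by
  rw [← LieSubmodule.mem_toSubmodule, LieSubmodule.lieIdeal_oper_eq_linear_span'] at hx
  induction hx using Submodule.span_induction with
  | mem x hx =>
    obtain ⟨a, ha, b, hb, rfl⟩ := hx
    rw [← hπ.sum_apply a, sum_lie, map_sum]
    refine sum_mem fun h _ ↦ ?_
    have : π g ⁅π h a, b⁆ = ⁅π h a, π (h⁻¹ * g) b⁆ := by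
      rw [← hπ.apply_lie_left, mul_inv_cancel_left]
    rw [this]
    exact LieSubmodule.lie_mem_lie (hI _ _ ha) (hJ _ _ hb)
  | zero => simp
  | add x y _ _ hx hy => rw [map_add]; exact add_mem hx hy
  | smul c x _ hx => rw [map_smul]; exact Submodule.smul_mem _ c hx

end IsLieGradingProj

/-- The quotient map of a Lie algebra by an ideal, as a morphism of Lie algebras. -/
def LieIdeal.mkHom {F L : Type*} [Field F] [LieRing L] [LieAlgebra F L] (I : LieIdeal F L) :
    L →ₗ⁅F⁆ L ⧸ I :=
  { LieSubmodule.Quotient.mk' I with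
    map_lie' := fun {x y} ↦ LieSubmodule.Quotient.mk_bracket I x y }

section Quotient

variable {F L : Type*} [Field F] [LieRing L] [LieAlgebra F L] (I : LieIdeal F L)

theorem LieIdeal.mkHom_surjective : Function.Surjective I.mkHom :=
  LieSubmodule.Quotient.surjective_mk' I

theorem LieIdeal.mkHom_eq_zero {x : L} : I.mkHom x = 0 ↔ x ∈ I :=
  LieSubmodule.Quotient.mk_eq_zero I

theorem IsLieGradingProj.exists_quotient {G : Type*} [Group G] [Fintype G] {π : G → L →ₗ[F] L}
    (hπ : IsLieGradingProj π) (hI : ∀ g, ∀ x ∈ I, π g x ∈ I) :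
    ∃ π' : G → (L ⧸ I) →ₗ[F] (L ⧸ I), IsLieGradingProj π' ∧
      ∀ g x, π' g (I.mkHom x) = I.mkHom (π g x) := by
  let π' : G → (L ⧸ I) →ₗ[F] (L ⧸ I) := fun g ↦
    I.toSubmodule.mapQ I.toSubmodule (π g) (hI g)
  have h : ∀ g x, π' g (I.mkHom x) = I.mkHom (π g x) := fun g x ↦ rfl
  refine ⟨π', ⟨?_, ?_, ?_, ?_⟩, h⟩
  · intro x
    obtain ⟨x, rfl⟩ := I.mkHom_surjective x
    simp only [h]
    rw [← map_sum, hπ.sum_apply]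
  · intro g x
    obtain ⟨x, rfl⟩ := I.mkHom_surjective x
    rw [h, h, hπ.apply_self]
  · intro g k x hgk
    obtain ⟨x, rfl⟩ := I.mkHom_surjective x
    rw [h, h, hπ.apply_of_ne _ _ _ hgk, map_zero]
  · intro g k x y
    obtain ⟨x, rfl⟩ := I.mkHom_surjective x
    obtain ⟨y, rfl⟩ := I.mkHom_surjective y
    rw [h, h, ← LieHom.map_lie, h, hπ.apply_lie]

theorem IsLieGradingProj.restrict {G : Type*} [Group G] [Fintype G] {π : G → L →ₗ[F] L}
    (hπ : IsLieGradingProj π) (M : LieSubalgebra F L) (hM : ∀ g, ∀ x ∈ M, π g x ∈ M) :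
    IsLieGradingProj (L := M) (fun g ↦ (π g).restrict (hM g)) := by
  refine ⟨?_, ?_, ?_, ?_⟩
  · intro x
    ext
    rw [AddSubmonoidClass.coe_finsetSum]
    exact hπ.sum_apply x
  · intro g x
    ext
    exact hπ.apply_self g x
  · intro g k x hgk
    ext
    exact hπ.apply_of_ne g k x hgk
  · intro g k x y
    ext
    exact hπ.apply_lie g k x y

/-- A morphism of Lie algebras factors through the quotient by an ideal it kills. -/
theorem LieHom.exists_comp_mkHom {S : Type*} [LieRing S] [LieAlgebra F S] (p : L →ₗ⁅F⁆ S)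
    (hI : ∀ x ∈ I, p x = 0) : ∃ p' : (L ⧸ I) →ₗ⁅F⁆ S, ∀ x, p' (I.mkHom x) = p x := by
  let q : (L ⧸ I) →ₗ[F] S := I.toSubmodule.liftQ (p : L →ₗ[F] S) hI
  have hq : ∀ x, q (I.mkHom x) = p x := fun x ↦ rfl
  refine ⟨{ q with map_lie' := ?_ }, fun x ↦ rfl⟩
  intro x y
  obtain ⟨x, rfl⟩ := I.mkHom_surjective x
  obtain ⟨y, rfl⟩ := I.mkHom_surjective y
  change q _ = ⁅q _, q _⁆
  rw [← LieHom.map_lie, hq, hq, hq, LieHom.map_lie]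

theorem LieIdeal.finrank_quotient_lt [FiniteDimensional F L] (hI : I ≠ ⊥) :
    Module.finrank F (L ⧸ I) < Module.finrank F L := by
  have h1 := Submodule.finrank_quotient_add_finrank I.toSubmodule
  have h2 : Module.finrank F I.toSubmodule ≠ 0 := by
    intro h
    exact hI ((LieSubmodule.toSubmodule_eq_bot I).mp (Submodule.finrank_eq_zero.mp h))
  change Module.finrank F (L ⧸ I.toSubmodule) < _
  omega

open LieAlgebra in
theorem LieIdeal.map_derivedSeriesOfIdeal_le {L' : Type*} [LieRing L'] [LieAlgebra F L']
    (f : L →ₗ⁅F⁆ L') (k : ℕ) :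
    (derivedSeriesOfIdeal F L k I).map f ≤ derivedSeriesOfIdeal F L' k (I.map f) := by
  induction k with
  | zero => simp
  | succ k ih =>
    rw [derivedSeriesOfIdeal_succ, derivedSeriesOfIdeal_succ]
    exact (LieIdeal.map_bracket_le f).trans (LieSubmodule.mono_lie ih ih)

/-- An extension of a solvable ideal of the quotient by a solvable ideal is solvable. -/
theorem LieIdeal.isSolvable_of_map_mkHom [LieAlgebra.IsSolvable I] (J : LieIdeal F L)
    (J' : LieIdeal F (L ⧸ I)) [LieAlgebra.IsSolvable J'] (hJ : J.map I.mkHom ≤ J') :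
    LieAlgebra.IsSolvable J := by
  obtain ⟨k, hk⟩ := LieAlgebra.IsSolvable.solvable F J'
  obtain ⟨l, hl⟩ := LieAlgebra.IsSolvable.solvable F I
  rw [LieIdeal.derivedSeries_eq_bot_iff] at hk hl
  refine LieAlgebra.IsSolvable.mk (R := F) (k := l + k) ?_
  rw [LieIdeal.derivedSeries_eq_bot_iff, LieAlgebra.derivedSeriesOfIdeal_add, eq_bot_iff, ← hl]
  refine LieAlgebra.derivedSeriesOfIdeal_mono ?_ l
  intro x hx
  rw [← I.mkHom_eq_zero]
  have h1 : I.mkHom x ∈ LieAlgebra.derivedSeriesOfIdeal F (L ⧸ I) k J' :=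
    LieAlgebra.derivedSeriesOfIdeal_mono hJ k
      (LieIdeal.map_derivedSeriesOfIdeal_le J I.mkHom k (LieIdeal.mem_map hx))
  rwa [hk, LieSubmodule.mem_bot] at h1

end Quotient

section Levi

universe u

variable {G : Type*} [Group G] [Fintype G] {F : Type*} [Field F]

/-- Replacing a linear map by its degree preserving component. -/
theorem IsLieGradingProj.exists_graded_retraction [CharZero F] {L S : Type*}
    [LieRing S] [LieAlgebra F S] [LieAlgebra.IsKilling F S] [FiniteDimensional F S]
    [LieRing L] [LieAlgebra F L] [FiniteDimensional F L] {π : G → L →ₗ[F] L}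
    (hπ : IsLieGradingProj π) (p : L →ₗ⁅F⁆ S) (hp : Function.Surjective p)
    (hstab : ∀ g x, p x = 0 → p (π g x) = 0)
    (hab : ∀ x y : L, p x = 0 → p y = 0 → ⁅x, y⁆ = 0) :
    ∃ f : L →ₗ[F] L, (∀ x, p (f x) = 0) ∧ (∀ x, p x = 0 → f x = x) ∧
      (∀ g x, f (π g x) = π g (f x)) ∧
      ∀ x : L, ∃ r : L, p r = 0 ∧ ∀ y : L, ⁅x, f y⁆ - f ⁅x, y⁆ = ⁅r, y⁆ := by
  obtain ⟨f, hfp, hf, hfr⟩ := LieHom.exists_retraction_ker_of_abelian p hp hab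
  choose r hr hfr using hfr
  let e : L →ₗ[F] L := ∑ k, π k ∘ₗ f ∘ₗ π k
  have he : ∀ x, e x = ∑ k, π k (f (π k x)) := fun x ↦ by simp [e]
  have heπ : ∀ g x, e (π g x) = π g (f (π g x)) := by
    intro g x
    rw [he, Finset.sum_eq_single g]
    · rw [hπ.apply_self]
    · intro k _ hk
      rw [hπ.apply_of_ne _ _ _ hk, map_zero, map_zero]
    · simp
  have hπe : ∀ g x, π g (e x) = π g (f (π g x)) := by
    intro g x
    rw [he, map_sum, Finset.sum_eq_single g]
    · rw [hπ.apply_self]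
    · intro k _ hk
      rw [hπ.apply_of_ne _ _ _ (Ne.symm hk)]
    · simp
  refine ⟨e, fun x ↦ ?_, fun x hx ↦ ?_, fun g x ↦ by rw [heπ, hπe], fun x ↦ ?_⟩
  · rw [he, map_sum]
    exact Finset.sum_eq_zero fun k _ ↦ hstab _ _ (hfp _)
  · rw [he]
    conv_rhs => rw [← hπ.sum_apply x]
    refine Finset.sum_congr rfl fun k _ ↦ ?_
    rw [hf _ (hstab k x hx), hπ.apply_self]
  · refine ⟨∑ h, π h (r (π h x)), ?_, fun y ↦ ?_⟩
    · rw [map_sum]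
      exact Finset.sum_eq_zero fun k _ ↦ hstab _ _ (hr _)
    · have key : ∀ h k, ⁅π h x, e (π k y)⁆ - e ⁅π h x, π k y⁆ = ⁅π h (r (π h x)), π k y⁆ := by
        intro h k
        have h1 : e ⁅π h x, π k y⁆ = π (h * k) (f ⁅π h x, π k y⁆) := by
          rw [← hπ.apply_lie, heπ, hπ.apply_lie]
        rw [heπ, h1, ← hπ.apply_lie_left, ← map_sub, hfr, hπ.apply_lie_right]
      have hx : ∀ y : L, ⁅x, y⁆ = ∑ h, ⁅π h x, y⁆ := fun y ↦ by
        rw [← sum_lie, hπ.sum_apply]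
      have h2 : ∀ h, ⁅π h x, e y⁆ - e ⁅π h x, y⁆ = ⁅π h (r (π h x)), y⁆ := by
        intro h
        conv_lhs => rw [← hπ.sum_apply y]
        conv_rhs => rw [← hπ.sum_apply y]
        rw [map_sum, lie_sum, lie_sum, lie_sum, map_sum, ← Finset.sum_sub_distrib]
        exact Finset.sum_congr rfl fun k _ ↦ key h k
      rw [hx, hx, map_sum, ← Finset.sum_sub_distrib, sum_lie]
      exact Finset.sum_congr rfl fun h _ ↦ h2 h

/-- **Graded Levi theorem**, in terms of a surjection onto a semisimple Lie algebra with solvable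
graded kernel. -/
theorem IsLieGradingProj.exists_graded_complement [CharZero F] {S : Type*}
    [LieRing S] [LieAlgebra F S] [LieAlgebra.IsKilling F S] [FiniteDimensional F S] (n : ℕ) :
    ∀ (L : Type u) [LieRing L] [LieAlgebra F L] [FiniteDimensional F L],
      Module.finrank F L = n → ∀ π : G → L →ₗ[F] L, IsLieGradingProj π →
      ∀ p : L →ₗ⁅F⁆ S, Function.Surjective p → LieAlgebra.IsSolvable p.ker →
      (∀ g x, p x = 0 → p (π g x) = 0) →
      ∃ B : LieSubalgebra F L, (∀ g, ∀ x ∈ B, π g x ∈ B) ∧ (∀ x ∈ B, p x = 0 → x = 0) ∧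
        ∀ a : S, ∃ x ∈ B, p x = a := by
  induction n using Nat.strong_induction_on with
  | _ n ih =>
  intro L _ _ _ hn π hπ p hp hsolv hstab
  -- it suffices to find a proper graded subalgebra supplementing the kernel
  have descend : ∀ M : LieSubalgebra F L, M ≠ ⊤ → (∀ g, ∀ x ∈ M, π g x ∈ M) →
      (∀ a : S, ∃ x ∈ M, p x = a) →
      ∃ B : LieSubalgebra F L, (∀ g, ∀ x ∈ B, π g x ∈ B) ∧ (∀ x ∈ B, p x = 0 → x = 0) ∧
        ∀ a : S, ∃ x ∈ B, p x = a := by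
    intro M hM hMπ hMp
    have hlt : Module.finrank F M < n := by
      rw [← hn]
      exact Submodule.finrank_lt fun h ↦ hM ((LieSubalgebra.toSubmodule_eq_top _).mp h)
    let p' : M →ₗ⁅F⁆ S := p.comp M.incl
    have hp' : ∀ x : M, p' x = p x := fun x ↦ rfl
    have hsolv' : LieAlgebra.IsSolvable p'.ker := by
      let j : p'.ker →ₗ⁅F⁆ p.ker :=
        { toFun := fun x ↦ ⟨x.1.1, (LieHom.mem_ker).mpr ((LieHom.mem_ker).mp x.2)⟩
          map_add' := fun x y ↦ rfl
          map_smul' := fun t x ↦ rfl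
          map_lie' := rfl }
      have hj : Function.Injective j := fun x y hxy ↦
        Subtype.ext (Subtype.ext (congrArg (fun z : p.ker ↦ (z : L)) hxy))
      exact hj.lieAlgebra_isSolvable
    obtain ⟨B, hB1, hB2, hB3⟩ := ih _ hlt M rfl _ (hπ.restrict M hMπ) p'
      (fun a ↦ by
        obtain ⟨x, hx, rfl⟩ := hMp a
        exact ⟨⟨x, hx⟩, rfl⟩)
      hsolv' (fun g x hx ↦ hstab g x hx)
    refine ⟨B.map M.incl, ?_, ?_, ?_⟩
    · rintro g _ ⟨x, hx, rfl⟩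
      exact ⟨_, hB1 g x hx, rfl⟩
    · rintro _ ⟨x, hx, rfl⟩ hpx
      have : x = 0 := hB2 x hx hpx
      rw [this]
      rfl
    · intro a
      obtain ⟨x, hx, rfl⟩ := hB3 a
      exact ⟨x, ⟨x, hx, rfl⟩, rfl⟩
  have hRπ : ∀ g, ∀ x ∈ p.ker, π g x ∈ p.ker := fun g x hx ↦
    (LieHom.mem_ker).mpr (hstab g x ((LieHom.mem_ker).mp hx))
  by_cases hD : (⁅p.ker, p.ker⁆ : LieIdeal F L) = ⊥
  · have hab : ∀ x y : L, p x = 0 → p y = 0 → ⁅x, y⁆ = 0 := fun x y hx hy ↦ by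
      have := LieSubmodule.lie_mem_lie ((LieHom.mem_ker).mpr hx) ((LieHom.mem_ker).mpr hy)
      rwa [hD, LieSubmodule.mem_bot] at this
    obtain ⟨f, hfp, hf, hfπ, hfr⟩ := hπ.exists_graded_retraction p hp hstab hab
    let M : LieSubalgebra F L :=
      { carrier := {x | ∀ y : L, ⁅x, f y⁆ = f ⁅x, y⁆}
        add_mem' := fun {a b} ha hb y ↦ by
          rw [add_lie, add_lie, map_add, ha y, hb y]
        zero_mem' := fun y ↦ by simp
        smul_mem' := fun t a ha y ↦ by
          rw [smul_lie, smul_lie, map_smul, ha y]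
        lie_mem' := fun {a b} ha hb y ↦ by
          rw [lie_lie, lie_lie, map_sub, hb y, ha y, ha, hb] }
    have hMmem : ∀ x, x ∈ M ↔ ∀ y : L, ⁅x, f y⁆ = f ⁅x, y⁆ := fun x ↦ Iff.rfl
    by_cases hM : M = ⊤
    · have hM' : ∀ x y : L, ⁅x, f y⁆ = f ⁅x, y⁆ := fun x ↦ by
        rw [← hMmem, hM]
        trivial
      have hcentral : ∀ r x : L, p r = 0 → ⁅x, r⁆ = 0 := by
        intro r x hr
        have h1 := hM' r x
        rw [hab _ _ hr (hfp x), hf _ (by rw [LieHom.map_lie, hr, zero_lie])] at h1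
        rw [← lie_skew, ← h1, neg_zero]
      have hf0 : ∀ x y : L, f ⁅x, y⁆ = 0 := fun x y ↦ by
        rw [← hM', hcentral _ _ (hfp y)]
      refine ⟨{ LinearMap.ker f with lie_mem' := fun {x y} _ _ ↦ hf0 x y }, ?_, ?_, ?_⟩
      · intro g x hx
        change f x = 0 at hx
        change f (π g x) = 0
        rw [hfπ, hx, map_zero]
      · intro x hx hpx
        change f x = 0 at hx
        rw [← hf x hpx, hx]
      · intro a
        obtain ⟨x, rfl⟩ := hp a
        refine ⟨x - f x, ?_, by rw [map_sub, hfp, sub_zero]⟩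
        change f (x - f x) = 0
        rw [map_sub, hf _ (hfp x), sub_self]
    · refine descend M hM ?_ ?_
      · intro g x hx y
        have key : ∀ k, ⁅π g x, f (π k y)⁆ = f ⁅π g x, π k y⁆ := by
          intro k
          rw [hfπ, ← hπ.apply_lie_right, ← hπ.apply_lie_right, hfπ, ← hfπ k, hx]
        rw [← hπ.sum_apply y, map_sum, lie_sum, lie_sum, map_sum]
        exact Finset.sum_congr rfl fun k _ ↦ key k
      · intro a
        obtain ⟨x, rfl⟩ := hp a
        obtain ⟨r, hr, hxr⟩ := hfr x
        refine ⟨x + r, ?_, by rw [map_add, hr, add_zero]⟩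
        intro y
        have h1 : f ⁅r, y⁆ = ⁅r, y⁆ := hf _ (by rw [LieHom.map_lie, hr, zero_lie])
        rw [add_lie, add_lie, map_add, hab r _ hr (hfp y), h1, ← hxr y]
        abel
  · set D : LieIdeal F L := ⁅p.ker, p.ker⁆ with hDdef
    have hDp : ∀ x ∈ D, p x = 0 := fun x hx ↦
      (LieHom.mem_ker).mp (LieSubmodule.lie_le_left p.ker p.ker hx)
    obtain ⟨π', hπ', hπ'mk⟩ := hπ.exists_quotient D fun g x ↦ hπ.apply_mem_lie hRπ hRπ g
    obtain ⟨p', hp'⟩ := p.exists_comp_mkHom D hDp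
    have hsolv' : LieAlgebra.IsSolvable p'.ker := by
      let j : p.ker →ₗ⁅F⁆ p'.ker :=
        { toFun := fun x ↦ ⟨D.mkHom x.1, (LieHom.mem_ker).mpr
            ((hp' x.1).trans ((LieHom.mem_ker).mp x.2))⟩
          map_add' := fun x y ↦ Subtype.ext (map_add D.mkHom x.1 y.1)
          map_smul' := fun t x ↦ Subtype.ext (map_smul D.mkHom t x.1)
          map_lie' := fun {x y} ↦ Subtype.ext (LieHom.map_lie D.mkHom x.1 y.1) }
      have hj : Function.Surjective j := by
        rintro ⟨x, hx⟩
        obtain ⟨x, rfl⟩ := D.mkHom_surjective x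
        rw [LieHom.mem_ker, hp'] at hx
        exact ⟨⟨x, (LieHom.mem_ker).mpr hx⟩, rfl⟩
      exact hj.lieAlgebra_isSolvable
    obtain ⟨B, hB1, hB2, hB3⟩ := ih _ (hn ▸ D.finrank_quotient_lt hD) (L ⧸ D) rfl π' hπ' p'
      (fun a ↦ by
        obtain ⟨x, rfl⟩ := hp a
        exact ⟨D.mkHom x, hp' x⟩)
      hsolv'
      (fun g x hx ↦ by
        obtain ⟨x, rfl⟩ := D.mkHom_surjective x
        rw [hp'] at hx
        rw [hπ'mk, hp', hstab g x hx])
    refine descend (B.comap D.mkHom) ?_ ?_ ?_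
    · intro htop
      have hle : p.ker ≤ D := by
        intro x hx
        have hxB : x ∈ B.comap D.mkHom := by rw [htop]; trivial
        rw [← D.mkHom_eq_zero]
        exact hB2 _ hxB ((hp' x).trans ((LieHom.mem_ker).mp hx))
      have heq : D = p.ker := le_antisymm (LieSubmodule.lie_le_left p.ker p.ker) hle
      have hder : ∀ k, LieAlgebra.derivedSeriesOfIdeal F L k p.ker = p.ker := by
        intro k
        induction k with
        | zero => rfl
        | succ k ihk => rw [LieAlgebra.derivedSeriesOfIdeal_succ, ihk, ← hDdef, heq]
      obtain ⟨k, hk⟩ := LieAlgebra.IsSolvable.solvable F p.ker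
      rw [LieIdeal.derivedSeries_eq_bot_iff, hder] at hk
      exact hD (heq.trans hk)
    · intro g x hx
      change D.mkHom (π g x) ∈ B
      rw [← hπ'mk]
      exact hB1 g _ hx
    · intro a
      obtain ⟨x, hx, rfl⟩ := hB3 a
      obtain ⟨x, rfl⟩ := D.mkHom_surjective x
      exact ⟨x, hx, (hp' x).symm⟩

/-- A graded Lie algebra admits a surjection onto a semisimple one with solvable graded kernel. -/
theorem IsLieGradingProj.exists_semisimple_quotient [CharZero F] (n : ℕ) :
    ∀ (L : Type u) [LieRing L] [LieAlgebra F L] [FiniteDimensional F L],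
      Module.finrank F L = n → ∀ π : G → L →ₗ[F] L, IsLieGradingProj π →
      ∃ (S : Type u) (_ : LieRing S) (_ : LieAlgebra F S) (_ : LieAlgebra.IsKilling F S)
        (_ : FiniteDimensional F S) (p : L →ₗ⁅F⁆ S), Function.Surjective p ∧
        LieAlgebra.IsSolvable p.ker ∧ ∀ g x, p x = 0 → p (π g x) = 0 := by
  induction n using Nat.strong_induction_on with
  | _ n ih =>
  intro L _ _ _ hn π hπ
  by_cases hK : LieIdeal.killingCompl F L ⊤ = ⊥
  · refine ⟨L, inferInstance, inferInstance, ⟨hK⟩, inferInstance, 1, fun x ↦ ⟨x, rfl⟩, ?_, ?_⟩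
    · have : (1 : L →ₗ⁅F⁆ L).ker = ⊥ := by
        rw [eq_bot_iff]
        intro x hx
        exact (LieHom.mem_ker).mp hx
      rw [this]
      infer_instance
    · rintro g x hx
      have hx' : x = 0 := hx
      simp [hx']
  · set K := LieIdeal.killingCompl F L ⊤
    have hKsolv : LieAlgebra.IsSolvable K :=
      (LieAlgebra.LieIdeal.solvable_iff_le_radical F L K).mpr
        (LieAlgebra.killingCompl_top_le_radical F L)
    obtain ⟨π', hπ', hπ'mk⟩ := hπ.exists_quotient K fun g x ↦ hπ.apply_mem_killingCompl_top g
    obtain ⟨S, i1, i2, i3, i4, p, hp, hsolv, hstab⟩ :=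
      ih _ (hn ▸ K.finrank_quotient_lt hK) (L ⧸ K) rfl π' hπ'
    refine ⟨S, i1, i2, i3, i4, p.comp K.mkHom, hp.comp K.mkHom_surjective, ?_, ?_⟩
    · refine K.isSolvable_of_map_mkHom _ p.ker ?_
      rw [LieIdeal.map_le_iff_le_comap]
      intro x hx
      exact hx
    · intro g x hx
      change p (K.mkHom (π g x)) = 0
      rw [← hπ'mk]
      exact hstab g _ hx

end Levi

end Grading

theorem IsLieGrading.exists_isLieGradingProj {G F L : Type*} [Group G] [Fintype G] [Field F]
    [LieRing L] [LieAlgebra F L] {𝒜 : G → Submodule F L} (h : IsLieGrading 𝒜) :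
    ∃ π : G → L →ₗ[F] L, IsLieGradingProj π ∧ ∀ g x, π g x ∈ 𝒜 g := by
  classical
  obtain ⟨hinternal, hlie⟩ := h
  have hinternal : DirectSum.IsInternal 𝒜 := by convert hinternal
  let _ := hinternal.chooseDecomposition
  let π : G → L →ₗ[F] L := fun g ↦
    (𝒜 g).subtype ∘ₗ DirectSum.component F G (fun i ↦ 𝒜 i) g ∘ₗ
      (DirectSum.decomposeLinearEquiv 𝒜).toLinearMap
  have hπ : ∀ g x, π g x = (DirectSum.decompose 𝒜 x g : L) := fun g x ↦ rfl
  have hmem : ∀ g x, π g x ∈ 𝒜 g := fun g x ↦ SetLike.coe_mem _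
  have hself : ∀ g, ∀ x ∈ 𝒜 g, π g x = x := fun g x hx ↦
    DirectSum.decompose_of_mem_same 𝒜 hx
  refine ⟨π, ⟨fun x ↦ ?_, fun g x ↦ hself g _ (hmem g x), fun g k x hgk ↦ ?_,
    fun g k x y ↦ hself _ _ (hlie g k _ (hmem g x) _ (hmem k y))⟩, hmem⟩
  · simp only [hπ]
    conv_rhs => rw [← DirectSum.sum_support_decompose 𝒜 x]
    symm
    refine Finset.sum_subset (Finset.subset_univ _) fun g _ hg ↦ ?_
    rw [DFinsupp.notMem_support_iff] at hg
    rw [hg]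
    rfl
  · exact DirectSum.decompose_of_mem_ne 𝒜 (hmem k x) (Ne.symm hgk)

/-- If `L` is a finite dimensional Lie algebra over an algebraically closed
field of characteristic zero, graded by a finite group `G`, then there exists a Levi
subalgebra `B` of `L` (a semisimple subalgebra with `L = B ⊕ Rad L` as vector spaces)
which is a graded subspace of `L`. -/
theorem exists_graded_levi_subalgebra {G F L : Type*} [Group G] [Finite G] [Field F]
    [IsAlgClosed F] [CharZero F] [LieRing L] [LieAlgebra F L] [FiniteDimensional F L]
    (𝒜 : G → Submodule F L) (hgr : IsLieGrading 𝒜) :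
    ∃ B : LieSubalgebra F L,
      IsGradedSubspace 𝒜 B.toSubmodule ∧
      LieAlgebra.radical F ↥B = ⊥ ∧
      IsCompl B.toSubmodule (LieAlgebra.radical F L).toSubmodule := by
  have := Fintype.ofFinite G
  obtain ⟨π, hπ, hmem⟩ := hgr.exists_isLieGradingProj
  obtain ⟨S, _, _, _, _, p, hp, hsolv, hstab⟩ :=
    IsLieGradingProj.exists_semisimple_quotient _ L rfl π hπ
  obtain ⟨B, hB1, hB2, hB3⟩ :=
    IsLieGradingProj.exists_graded_complement _ L rfl π hπ p hp hsolv hstab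
  have hS : LieAlgebra.radical F S = ⊥ := LieAlgebra.HasTrivialRadical.radical_eq_bot
  have hrad : LieAlgebra.radical F L = p.ker := by
    refine le_antisymm ?_ ((LieAlgebra.LieIdeal.solvable_iff_le_radical F L _).mp hsolv)
    intro x hx
    have hsol : LieAlgebra.IsSolvable ((LieAlgebra.radical F L).map p) := by
      let j : LieAlgebra.radical F L →ₗ⁅F⁆ (LieAlgebra.radical F L).map p :=
        { toFun := fun x ↦ ⟨p x.1, LieIdeal.mem_map x.2⟩
          map_add' := fun x y ↦ Subtype.ext (map_add p x.1 y.1)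
          map_smul' := fun t x ↦ Subtype.ext (map_smul p t x.1)
          map_lie' := fun {x y} ↦ Subtype.ext (LieHom.map_lie p x.1 y.1) }
      have hj : Function.Surjective j := by
        rintro ⟨y, hy⟩
        obtain ⟨x, rfl⟩ := LieIdeal.mem_map_of_surjective hp hy
        exact ⟨x, rfl⟩
      exact hj.lieAlgebra_isSolvable
    have h1 := (LieAlgebra.LieIdeal.solvable_iff_le_radical F S _).mp hsol (LieIdeal.mem_map hx)
    rw [hS, LieSubmodule.mem_bot] at h1
    exact (LieHom.mem_ker).mpr h1
  refine ⟨B, ?_, ?_, ?_⟩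
  · refine le_antisymm (fun x hx ↦ ?_) (iSup_le fun g ↦ inf_le_right)
    rw [← hπ.sum_apply x]
    exact sum_mem fun g _ ↦ Submodule.mem_iSup_of_mem g ⟨hmem g x, hB1 g x hx⟩
  · let e : B ≃ₗ⁅F⁆ S := LieEquiv.ofBijective (p.comp B.incl) ⟨by
      rw [injective_iff_map_eq_zero]
      exact fun x hx ↦ Subtype.ext (hB2 x x.2 hx), fun a ↦ by
      obtain ⟨x, hx, rfl⟩ := hB3 a
      exact ⟨⟨x, hx⟩, rfl⟩⟩
    have : LieAlgebra.IsKilling F B := LieAlgebra.isKilling_of_equiv e.symm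
    exact LieAlgebra.HasTrivialRadical.radical_eq_bot
  · rw [hrad]
    refine ⟨?_, ?_⟩
    · rw [Submodule.disjoint_def]
      exact fun x hx hx' ↦ hB2 x hx ((LieHom.mem_ker).mp hx')
    · rw [codisjoint_iff, eq_top_iff]
      intro x _
      obtain ⟨b, hb, hbx⟩ := hB3 (p x)
      refine Submodule.mem_sup.mpr ⟨b, hb, x - b, ?_, by abel⟩
      exact (LieHom.mem_ker).mpr (by rw [map_sub, hbx, sub_self])
end
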